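/- For all integers k, l ≥ 0, every function F : ℂ^m × ℂ^r → ℂ, and every point (x, y) ∈ ℂ^m × ℂ^r that is admissible for the identity (every bracket value occurring in a denominator of any coefficient of either iterated sum is nonzero), one has (H_{m,r}^{(k)} (Ĥ_{m,r}^{(l)} F))(x; y) = (Ĥ_{m,r}^{(l)} (H_{m,r}^{(k)} F))(x; y). -/

import Mathlib

open Finset

/-- Shifted factorial `[x; a]_k` for `k ∈ ℤ`:
`[x; a]_k = [x][x+a]⋯[x+(k-1)a]` for `k ≥ 0` and `[x; a]_{-k} = 1/[x-ka; a]_k`. -/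
noncomputable def sfac (br : ℂ → ℂ) (a x : ℂ) (k : ℤ) : ℂ :=
  if 0 ≤ k then ∏ i ∈ Finset.range k.toNat, br (x + (i : ℂ) * a)
  else (∏ i ∈ Finset.range (-k).toNat, br (x + ((k : ℂ) + (i : ℂ)) * a))⁻¹

/-- The coefficient `C_{μ,I}(x; y; a, b)`. -/
noncomputable def Coef (br : ℂ → ℂ) (a b : ℂ) {m r : ℕ} (μ : Fin m → ℕ)
    (I : Finset (Fin r)) (x : Fin m → ℂ) (y : Fin r → ℂ) : ℂ :=
  (-1 : ℂ) ^ I.card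
    * (∏ i : Fin m, ∏ j : Fin m,
        if i < j then br (x i - x j + ((μ i : ℂ) - (μ j : ℂ)) * a) / br (x i - x j) else 1)
    * (∏ i ∈ I, ∏ j ∈ Iᶜ, br (y i - y j - a) / br (y i - y j))
    * (∏ i : Fin m, ∏ j : Fin m,
        sfac br a (x i - x j + b) (μ i : ℤ) / sfac br a (x i - x j + a) (μ i : ℤ))
    * ∏ i : Fin m,
        ((∏ j ∈ I, br (x i - y j - b) / br (x i - y j + (μ i : ℂ) * a))
          * ∏ j ∈ Iᶜ, br (x i - y j - a) / br (x i - y j + ((μ i : ℂ) - 1) * a))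

/-- Index set of the sums: pairs `(μ, I)` with `μ ∈ ℤ_{≥0}^m`, `I ⊆ {1,…,r}`, `|μ|+|I| = k`. -/
def idxSet (m r k : ℕ) : Finset ((Fin m → ℕ) × Finset (Fin r)) :=
  ((Fintype.piFinset fun _ : Fin m => Finset.range (k + 1)) ×ˢ
      (Finset.univ : Finset (Finset (Fin r)))).filter
    fun p => (∑ i, p.1 i) + p.2.card = k

def xshift (c : ℂ) {m : ℕ} (μ : Fin m → ℕ) (x : Fin m → ℂ) : Fin m → ℂ :=
  fun i => x i + c * (μ i : ℂ)

def xshiftI (c : ℂ) {m : ℕ} (I : Finset (Fin m)) (x : Fin m → ℂ) : Fin m → ℂ :=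
  fun i => x i + c * (if i ∈ I then 1 else 0)

def yshift (c : ℂ) {r : ℕ} (I : Finset (Fin r)) (y : Fin r → ℂ) : Fin r → ℂ :=
  fun j => y j - c * (if j ∈ I then 1 else 0)

def yshiftMu (c : ℂ) {r : ℕ} (μ : Fin r → ℕ) (y : Fin r → ℂ) : Fin r → ℂ :=
  fun j => y j - c * (μ j : ℂ)

/-- The deformed elliptic Ruijsenaars operator `H_{m,r}^{(k)}`. -/
noncomputable def Hop (br : ℂ → ℂ) (δ κ : ℂ) (m r k : ℕ)
    (F : (Fin m → ℂ) → (Fin r → ℂ) → ℂ) (x : Fin m → ℂ) (y : Fin r → ℂ) : ℂ :=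
  ∑ p ∈ idxSet m r k, Coef br δ κ p.1 p.2 x y * F (xshift δ p.1 x) (yshift κ p.2 y)

/-- The operator `D_{m,r}^{(k)}`. -/
noncomputable def Dop (br : ℂ → ℂ) (δ κ : ℂ) (m r k : ℕ)
    (F : (Fin m → ℂ) → (Fin r → ℂ) → ℂ) (x : Fin m → ℂ) (y : Fin r → ℂ) : ℂ :=
  ∑ p ∈ idxSet r m k, Coef br (-κ) (-δ) p.1 p.2 y x * F (xshiftI δ p.2 x) (yshiftMu κ p.1 y)

/-- The operator `Ĥ_{m,r}^{(k)}`. -/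
noncomputable def Hhat (br : ℂ → ℂ) (δ κ : ℂ) (m r k : ℕ)
    (F : (Fin m → ℂ) → (Fin r → ℂ) → ℂ) (x : Fin m → ℂ) (y : Fin r → ℂ) : ℂ :=
  ∑ p ∈ idxSet m r k,
    Coef br (-δ) (-κ) p.1 p.2 (fun i => x i - δ) (fun j => y j + κ)
      * F (xshift (-δ) p.1 x) (yshift (-κ) p.2 y)

/-- The operator `D̂_{m,r}^{(k)}`. -/
noncomputable def Dhat (br : ℂ → ℂ) (δ κ : ℂ) (m r k : ℕ)
    (F : (Fin m → ℂ) → (Fin r → ℂ) → ℂ) (x : Fin m → ℂ) (y : Fin r → ℂ) : ℂ :=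
  ∑ p ∈ idxSet r m k,
    Coef br κ δ p.1 p.2 (fun j => y j + κ) (fun i => x i - δ)
      * F (xshiftI (-δ) p.2 x) (yshiftMu (-κ) p.1 y)

/-- Nonvanishing of all bracket values occurring in denominators of `C_{μ,I}(x; y; a, b)`. -/
def CDenomNZ (br : ℂ → ℂ) (a : ℂ) {m r : ℕ} (μ : Fin m → ℕ)
    (I : Finset (Fin r)) (x : Fin m → ℂ) (y : Fin r → ℂ) : Prop :=
  (∀ i j : Fin m, i < j → br (x i - x j) ≠ 0)
    ∧ (∀ i ∈ I, ∀ j ∈ Iᶜ, br (y i - y j) ≠ 0)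
    ∧ (∀ i j : Fin m, sfac br a (x i - x j + a) (μ i : ℤ) ≠ 0)
    ∧ (∀ i : Fin m, ∀ j ∈ I, br (x i - y j + (μ i : ℂ) * a) ≠ 0)
    ∧ (∀ i : Fin m, ∀ j ∈ Iᶜ, br (x i - y j + ((μ i : ℂ) - 1) * a) ≠ 0)

section ThetaInterpolation

variable {br : ℂ → ℂ}

lemma dense_bracket_ne_zero (hent : Differentiable ℂ br) (hnz : br ≠ 0) :
    Dense {z : ℂ | br z ≠ 0} := by
  intro z
  rw [mem_closure_iff_frequently]
  intro h
  apply hnz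
  have han : AnalyticOnNhd ℂ br Set.univ := fun w _ => hent.analyticAt w
  refine han.eq_of_eventuallyEq (g := 0) (fun w _ => analyticAt_const) (z₀ := z) ?_
  filter_upwards [h] with w hw
  simpa using hw

lemma bracket_zero (hodd : ∀ z : ℂ, br (-z) = -br z) : br 0 = 0 := by
  have h := hodd 0
  rw [neg_zero] at h
  linear_combination h / 2

/-- Two-node interpolation of a product of two brackets. -/
lemma bracket_mul_bracket_exchange (hodd : ∀ z : ℂ, br (-z) = -br z)
    (hW : ∀ a b c d : ℂ,
      br (a + b) * br (a - b) * br (c + d) * br (c - d)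
        + br (a + d) * br (a - d) * br (b + c) * br (b - c)
        = br (a + c) * br (a - c) * br (b + d) * br (b - d)) (v s t c d : ℂ) :
    br (v + c) * br (v + d) * (br (s - t) * br (s + t + (c + d)))
      = br (v - t) * br (v + t + (c + d)) * (br (s + c) * br (s + d))
        - br (v - s) * br (v + s + (c + d)) * (br (t + c) * br (t + d)) := by
  have h := hW (v + (c + d) / 2) (t + (c + d) / 2) (s + (c + d) / 2) ((c - d) / 2)
  have e1 : v + (c + d) / 2 + (t + (c + d) / 2) = v + t + (c + d) := by ring
  have e2 : v + (c + d) / 2 - (t + (c + d) / 2) = v - t := by ring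
  have e3 : s + (c + d) / 2 + (c - d) / 2 = s + c := by ring
  have e4 : s + (c + d) / 2 - (c - d) / 2 = s + d := by ring
  have e5 : v + (c + d) / 2 + (c - d) / 2 = v + c := by ring
  have e6 : v + (c + d) / 2 - (c - d) / 2 = v + d := by ring
  have e7 : t + (c + d) / 2 + (s + (c + d) / 2) = s + t + (c + d) := by ring
  have e8 : t + (c + d) / 2 - (s + (c + d) / 2) = -(s - t) := by ring
  have e9 : v + (c + d) / 2 + (s + (c + d) / 2) = v + s + (c + d) := by ring
  have e10 : v + (c + d) / 2 - (s + (c + d) / 2) = v - s := by ring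
  have e11 : t + (c + d) / 2 + (c - d) / 2 = t + c := by ring
  have e12 : t + (c + d) / 2 - (c - d) / 2 = t + d := by ring
  rw [e1, e2, e3, e4, e5, e6, e7, e8, e9, e10, e11, e12, hodd] at h
  linear_combination -h

variable {ι : Type*} [DecidableEq ι]

/-- `f` is recovered at `u` from its values at the nodes `t i`, `i ∈ S`, by the Lagrange
interpolation formula with multiplier `σ`. -/
def IsInterpolated (br : ℂ → ℂ) (S : Finset ι) (t : ι → ℂ) (σ u : ℂ) (f : ℂ → ℂ) : Prop :=
  f u * br σ = ∑ k ∈ S, f (t k) * (br (u - t k + σ) * ∏ j ∈ S.erase k, br (u - t j) / br (t k - t j))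

lemma IsInterpolated.mul_node (hodd : ∀ z : ℂ, br (-z) = -br z) {S : Finset ι} {t : ι → ℂ}
    {σ u : ℂ} {f : ℂ → ℂ} {i : ι} (hi : i ∈ S)
    (ht : ∀ j ∈ S, j ≠ i → br (t j - t i) ≠ 0)
    (h : IsInterpolated br (S.erase i) t σ u f) :
    IsInterpolated br S t σ u (fun v => br (v - t i) * f v) := by
  unfold IsInterpolated at *
  rw [← Finset.add_sum_erase S _ hi]
  simp only [sub_self, bracket_zero hodd, zero_mul, zero_add]
  rw [mul_assoc, h, Finset.mul_sum]
  refine Finset.sum_congr rfl fun k hk => ?_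
  have hki := Finset.ne_of_mem_erase hk
  have hkS := Finset.mem_of_mem_erase hk
  have hmem : i ∈ S.erase k := Finset.mem_erase.2 ⟨hki.symm, hi⟩
  rw [← Finset.mul_prod_erase (S.erase k) _ hmem, Finset.erase_right_comm]
  have := ht k hkS hki
  field_simp

lemma isInterpolated_prod (hodd : ∀ z : ℂ, br (-z) = -br z) (hent : Differentiable ℂ br)
    (hnz : br ≠ 0)
    (hW : ∀ a b c d : ℂ,
      br (a + b) * br (a - b) * br (c + d) * br (c - d)
        + br (a + d) * br (a - d) * br (b + c) * br (b - c)
        = br (a + c) * br (a - c) * br (b + d) * br (b - d))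
    (S : Finset ι) (t : ι → ℂ) (ht : ∀ i ∈ S, ∀ j ∈ S, i ≠ j → br (t i - t j) ≠ 0) (c : ι → ℂ)
    (u : ℂ) :
    IsInterpolated br S t (∑ j ∈ S, (c j + t j)) u (fun v => ∏ j ∈ S, br (v + c j)) := by
  induction S using Finset.strongInduction generalizing c with
  | H S ih =>
  rcases S.eq_empty_or_nonempty with rfl | ⟨i, hi⟩
  · simp [IsInterpolated, bracket_zero hodd]
  rcases (S.erase i).eq_empty_or_nonempty with hS | ⟨j, hj⟩
  · obtain rfl : S = {i} := by
      rw [← Finset.insert_erase hi, hS, insert_empty_eq]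
    simp only [IsInterpolated, prod_singleton, sum_singleton, Finset.erase_singleton, prod_empty,
      mul_one]
    rw [show u - t i + (c i + t i) = u + c i by ring, show t i + c i = c i + t i by ring]
    ring
  have hji := Finset.ne_of_mem_erase hj
  have hjS := Finset.mem_of_mem_erase hj
  have hij : i ∈ S.erase j := Finset.mem_erase.2 ⟨hji.symm, hi⟩
  -- the generic case
  have key : ∀ c : ι → ℂ, br (t i + t j + (c i + c j)) ≠ 0 →
      IsInterpolated br S t (∑ j ∈ S, (c j + t j)) u (fun v => ∏ j ∈ S, br (v + c j)) := by
    intro c hc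
    have sub : ∀ a ∈ S, ∀ b ∈ S.erase a, br (t a - t b) ≠ 0 →
        IsInterpolated br S t (∑ j ∈ S, (c j + t j)) u (fun v => br (v - t a) *
          ∏ k ∈ S.erase a, br (v + Function.update c b (t a + (c a + c b)) k)) := by
      intro a ha b hb hab
      refine IsInterpolated.mul_node hodd ha (fun k hk hka => ht k hk a ha hka) ?_
      have h1 := ih (S.erase a) (Finset.erase_ssubset ha)
        (fun p hp q hq => ht p (Finset.mem_of_mem_erase hp) q (Finset.mem_of_mem_erase hq))
        (Function.update c b (t a + (c a + c b)))
      have h2 : ∑ k ∈ S.erase a, (Function.update c b (t a + (c a + c b)) k + t k)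
          = ∑ j ∈ S, (c j + t j) := by
        rw [← Finset.add_sum_erase S _ ha, ← Finset.add_sum_erase _ _ hb,
          ← Finset.add_sum_erase (S.erase a) (fun j => c j + t j) hb]
        rw [Finset.sum_congr rfl (g := fun j => c j + t j)]
        · rw [Function.update_self]; ring
        · intro k hk
          rw [Function.update_of_ne (Finset.ne_of_mem_erase hk)]
      rwa [h2] at h1
    have s1 := sub j hjS i hij (ht j hjS i hi hji)
    have s2 := sub i hi j hj (ht i hi j hjS hji.symm)
    have hprod : ∀ a ∈ S, ∀ b ∈ S.erase a, ∀ v, ∏ k ∈ S.erase a,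
        br (v + Function.update c b (t a + (c a + c b)) k)
          = br (v + t a + (c a + c b)) * ∏ k ∈ (S.erase a).erase b, br (v + c k) := by
      intro a ha b hb v
      rw [← Finset.mul_prod_erase _ _ hb, Function.update_self]
      congr 1
      · ring_nf
      · exact Finset.prod_congr rfl fun k hk => by
          rw [Function.update_of_ne (Finset.ne_of_mem_erase hk)]
    have hf : ∀ v, (∏ k ∈ S, br (v + c k)) * (br (t i - t j) * br (t i + t j + (c i + c j)))
        = (br (t i + c i) * br (t i + c j)) * (br (v - t j) *
          ∏ k ∈ S.erase j, br (v + Function.update c i (t j + (c j + c i)) k))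
        - (br (t j + c i) * br (t j + c j)) * (br (v - t i) *
          ∏ k ∈ S.erase i, br (v + Function.update c j (t i + (c i + c j)) k)) := by
      intro v
      rw [hprod j hjS i hij, hprod i hi j hj, ← Finset.mul_prod_erase S _ hi,
        ← Finset.mul_prod_erase _ _ hj, Finset.erase_right_comm (a := j) (b := i)]
      have h := bracket_mul_bracket_exchange hodd hW v (t i) (t j) (c i) (c j)
      rw [add_comm (c j) (c i)]
      linear_combination (∏ k ∈ (S.erase i).erase j, br (v + c k)) * h
    have hD : br (t i - t j) * br (t i + t j + (c i + c j)) ≠ 0 :=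
      mul_ne_zero (ht i hi j hjS hji.symm) hc
    unfold IsInterpolated at s1 s2 ⊢
    apply mul_right_cancel₀ hD
    beta_reduce at s1 s2 ⊢
    rw [mul_right_comm, hf, sub_mul, mul_assoc (br (t i + c i) * br (t i + c j)), s1,
      mul_assoc (br (t j + c i) * br (t j + c j)), s2, Finset.mul_sum, Finset.mul_sum,
      ← Finset.sum_sub_distrib, Finset.sum_mul]
    refine Finset.sum_congr rfl fun k _ => ?_
    linear_combination (-(br (u - t k + ∑ j ∈ S, (c j + t j)) *
      ∏ j ∈ S.erase k, br (u - t j) / br (t k - t j))) * hf (t k)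
  have hcont := hent.continuous
  have hdense : Dense {w : ℂ | br (t i + t j + (w + c j)) ≠ 0} := by
    have := (dense_bracket_ne_zero hent hnz).preimage
      (Homeomorph.addRight (t i + t j + c j)).isOpenMap
    convert this using 1
    ext w
    simp only [Set.mem_ofPred_eq, Set.mem_preimage, Homeomorph.coe_addRight]
    ring_nf
  have hcu : ∀ k, Continuous fun w : ℂ => Function.update c i w k := fun k =>
    (continuous_apply k).comp ((continuous_const (y := c)).update i continuous_id)
  have heq := Continuous.ext_on (f := fun w => (∏ k ∈ S, br (u + Function.update c i w k)) *
      br (∑ k ∈ S, (Function.update c i w k + t k)))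
    (g := fun w => ∑ k ∈ S, (∏ l ∈ S, br (t k + Function.update c i w l)) *
      (br (u - t k + ∑ k ∈ S, (Function.update c i w k + t k)) *
        ∏ l ∈ S.erase k, br (u - t l) / br (t k - t l))) hdense (by fun_prop) (by fun_prop)
    (fun w hw => key (Function.update c i w) (by
      rw [Function.update_self, Function.update_of_ne hji]; exact hw))
  have := congrFun heq (c i)
  simpa only [Function.update_eq_self, IsInterpolated] using this

/-- A linear combination of products of brackets with equal number of factors and equal sum of
arguments vanishes identically once it vanishes at sufficiently many nodes. -/
lemma sum_prod_bracket_eq_zero (hodd : ∀ z : ℂ, br (-z) = -br z) (hent : Differentiable ℂ br)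
    (hnz : br ≠ 0)
    (hW : ∀ a b c d : ℂ,
      br (a + b) * br (a - b) * br (c + d) * br (c - d)
        + br (a + d) * br (a - d) * br (b + c) * br (b - c)
        = br (a + c) * br (a - c) * br (b + d) * br (b - d))
    [Fintype ι] {α : Type*} (A : Finset α) (w : α → ℂ) (c : α → ι → ℂ) (t : ι → ℂ) (σ : ℂ)
    (hc : ∀ a ∈ A, ∑ j, (c a j + t j) = σ)
    (ht : ∀ i j, i ≠ j → br (t i - t j) ≠ 0) (hσ : br σ ≠ 0)
    (h0 : ∀ i, ∑ a ∈ A, w a * ∏ j, br (t i + c a j) = 0) (u : ℂ) :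
    ∑ a ∈ A, w a * ∏ j, br (u + c a j) = 0 := by
  apply mul_right_cancel₀ hσ
  rw [zero_mul, Finset.sum_mul]
  have : ∀ a ∈ A, w a * (∏ j, br (u + c a j)) * br σ = ∑ k : ι, w a * (∏ j, br (t k + c a j)) *
      (br (u - t k + σ) * ∏ j ∈ univ.erase k, br (u - t j) / br (t k - t j)) := by
    intro a ha
    have h := isInterpolated_prod hodd hent hnz hW univ t (fun i _ j _ => ht i j) (c a) u
    rw [hc a ha] at h
    unfold IsInterpolated at h
    rw [mul_assoc, h, Finset.mul_sum]
    exact Finset.sum_congr rfl fun k _ => by ring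
  rw [Finset.sum_congr rfl this, Finset.sum_comm]
  refine Finset.sum_eq_zero fun k _ => ?_
  rw [← Finset.sum_mul, h0, zero_mul]

end ThetaInterpolation

section ShiftedFactorial

variable {br : ℂ → ℂ} {δ : ℂ}

/-- The shifted factorial `[u][u + δ]⋯[u + (k - 1)δ]` with a natural number of factors. -/
noncomputable def poch (br : ℂ → ℂ) (δ u : ℂ) (k : ℕ) : ℂ :=
  ∏ i ∈ Finset.range k, br (u + (i : ℂ) * δ)

@[simp] lemma poch_zero (u : ℂ) : poch br δ u 0 = 1 := by simp [poch]

@[simp] lemma poch_one (u : ℂ) : poch br δ u 1 = br u := by simp [poch]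

lemma poch_succ (u : ℂ) (k : ℕ) : poch br δ u (k + 1) = poch br δ u k * br (u + (k : ℂ) * δ) := by
  simp [poch, Finset.prod_range_succ]

lemma poch_add (u : ℂ) (a b : ℕ) :
    poch br δ u (a + b) = poch br δ u a * poch br δ (u + (a : ℂ) * δ) b := by
  unfold poch
  rw [Finset.prod_range_add]
  congr 1
  refine Finset.prod_congr rfl fun i _ => ?_
  push_cast
  ring_nf

lemma poch_ne_zero {u : ℂ} {k : ℕ} (h : ∀ s < k, br (u + (s : ℂ) * δ) ≠ 0) :
    poch br δ u k ≠ 0 :=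
  Finset.prod_ne_zero_iff.2 fun s hs => h s (Finset.mem_range.1 hs)

lemma poch_reflect (hodd : ∀ z : ℂ, br (-z) = -br z) (u : ℂ) (k : ℕ) :
    poch br δ u k = (-1) ^ k * poch br δ (-u - ((k : ℂ) - 1) * δ) k := by
  unfold poch
  rw [← Finset.prod_range_reflect]
  have : ((-1 : ℂ)) ^ k = ∏ _i ∈ range k, (-1 : ℂ) := by simp
  rw [this, ← Finset.prod_mul_distrib]
  refine Finset.prod_congr rfl fun i hi => ?_
  have hi' := Finset.mem_range.1 hi
  rw [neg_one_mul, ← hodd, show k - 1 - i = k - (i + 1) by omega, Nat.cast_sub (by omega)]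
  push_cast
  ring_nf

lemma poch_neg_neg (hodd : ∀ z : ℂ, br (-z) = -br z) (u : ℂ) (k : ℕ) :
    poch br (-δ) (-u) k = (-1) ^ k * poch br δ u k := by
  unfold poch
  have : ((-1 : ℂ)) ^ k = ∏ _i ∈ range k, (-1 : ℂ) := by simp
  rw [this, ← Finset.prod_mul_distrib]
  refine Finset.prod_congr rfl fun i hi => ?_
  rw [neg_one_mul, ← hodd]
  ring_nf

lemma prod_fin_ite (u v : ℂ) {a n : ℕ} (h : a ≤ n) :
    ∏ s : Fin n, br (if (s : ℕ) < a then u + ((s : ℕ) : ℂ) * δ else v + ((s : ℕ) : ℂ) * δ)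
      = poch br δ u a * poch br δ (v + (a : ℂ) * δ) (n - a) := by
  rw [Fin.prod_univ_eq_prod_range
    (fun s : ℕ => br (if s < a then u + (s : ℂ) * δ else v + (s : ℂ) * δ)) n]
  obtain ⟨b, rfl⟩ := Nat.exists_eq_add_of_le h
  rw [Finset.prod_range_add, Nat.add_sub_cancel_left]
  unfold poch
  congr 1
  · exact Finset.prod_congr rfl fun s hs => by rw [if_pos (Finset.mem_range.1 hs)]
  · refine Finset.prod_congr rfl fun s _ => ?_
    rw [if_neg (by omega)]
    push_cast
    ring_nf

end ShiftedFactorial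

section SourceIdentity

variable {br : ℂ → ℂ} {δ : ℂ} {ι : Type*}

/-- The factor attached to the pair `(i, j)` in the terms of the source identity. -/
noncomputable def sourcePair (br : ℂ → ℂ) (δ q : ℂ) (X Z : ι → ℂ) (μ : ι → ℕ) (i j : ι) : ℂ :=
  poch br δ (q + X i - X j - (μ j : ℂ) * δ) (μ i) * poch br δ (X i - Z j) (μ i) /
    (poch br δ (X i - X j - (μ j : ℂ) * δ) (μ i) * poch br δ (q + X i - Z j) (μ i))

/-- The terms of the source identity. -/
noncomputable def sourceTerm [Fintype ι] (br : ℂ → ℂ) (δ q : ℂ) (X Z : ι → ℂ) (μ : ι → ℕ) : ℂ :=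
  ∏ i, ∏ j, sourcePair br δ q X Z μ i j

/-- Term of the source identity after clearing the denominators depending on `q`. -/
noncomputable def clearedPair (br : ℂ → ℂ) (δ : ℂ) (n : ℕ) (q : ℂ) (X Z : ι → ℂ) (μ : ι → ℕ)
    (i j : ι) : ℂ :=
  poch br δ (X i - Z j) (μ i) / poch br δ (X i - X j - (μ j : ℂ) * δ) (μ i) *
    (poch br δ (q + X i - X j - (μ j : ℂ) * δ) (μ i) *
      poch br δ (q + X i - Z j + (μ i : ℂ) * δ) (n - μ i))

lemma sourcePair_mul {n : ℕ} {q : ℂ} {X Z : ι → ℂ} {μ : ι → ℕ} {i j : ι} (h : μ i ≤ n)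
    (hq : poch br δ (q + X i - Z j) n ≠ 0) :
    sourcePair br δ q X Z μ i j * poch br δ (q + X i - Z j) n
      = clearedPair br δ n q X Z μ i j := by
  obtain ⟨b, hb⟩ := Nat.exists_eq_add_of_le h
  unfold sourcePair clearedPair
  rw [hb, poch_add] at hq
  rw [hb, Nat.add_sub_cancel_left, poch_add]
  have h1 := left_ne_zero_of_mul hq
  rw [div_mul_eq_mul_div, div_mul_eq_mul_div, mul_comm (poch br δ (X i - X j - _) _),
    ← div_div]
  congr 1
  field_simp

/-- Points at which all the denominators and nodes of the source identity are nondegenerate. -/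
structure IsGenericPair [Fintype ι] (br : ℂ → ℂ) (δ : ℂ) (X Z : ι → ℂ) : Prop where
  pair : ∀ (i j i' j' : ι) (k : ℤ), (i, j) ≠ (i', j') →
    br (Z j - X i - (Z j' - X i') + (k : ℂ) * δ) ≠ 0
  cross : ∀ (i j : ι) (k : ℤ), br (X i - Z j + (k : ℂ) * δ) ≠ 0
  total : ∀ (n : ℕ) (k : ℤ), 1 ≤ n → br ((n : ℂ) * ∑ i, (Z i - X i) + (k : ℂ) * δ) ≠ 0

lemma IsGenericPair.neg_swap [Fintype ι] {X Z : ι → ℂ} (h : IsGenericPair br δ X Z) :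
    IsGenericPair br δ (-Z) (-X) where
  pair i j i' j' k hne := by
    have := h.pair j i j' i' k (by grind)
    convert this using 2
    simp only [Pi.neg_apply]
    ring
  cross i j k := by
    have := h.cross j i k
    convert this using 2
    simp only [Pi.neg_apply]
    ring
  total n k hn := by
    have := h.total n k hn
    convert this using 5
    simp only [Pi.neg_apply]
    ring

lemma IsGenericPair.shift [Fintype ι] {X Z : ι → ℂ} (h : IsGenericPair br δ X Z)
    (a b : ι → ℤ) :
    IsGenericPair br δ (fun i => X i + (a i : ℂ) * δ) (fun i => Z i + (b i : ℂ) * δ) where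
  pair i j i' j' k hne := by
    have := h.pair i j i' j' (k + (b j - a i - (b j' - a i'))) hne
    convert this using 2
    push_cast
    ring
  cross i j k := by
    have := h.cross i j (k + (a i - b j))
    convert this using 2
    push_cast
    ring
  total n k hn := by
    have := h.total n (k + n * ∑ i, (b i - a i)) hn
    convert this using 2
    have : ∑ i, (Z i + (b i : ℂ) * δ - (X i + (a i : ℂ) * δ))
        = ∑ i, (Z i - X i) + (∑ i, ((b i : ℂ) - (a i : ℂ))) * δ := by
      rw [Finset.sum_mul, ← Finset.sum_add_distrib]
      exact Finset.sum_congr rfl fun i _ => by ring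
    rw [this]
    push_cast
    ring

lemma IsGenericPair.sub_left [Fintype ι] {X Z : ι → ℂ} (h : IsGenericPair br δ X Z) {i j : ι}
    (hij : i ≠ j) (k : ℤ) : br (X i - X j + (k : ℂ) * δ) ≠ 0 := by
  have := h.pair j i i i k (by grind)
  convert this using 2
  ring

/-- The denominators of the source terms depending only on the differences of the `X i`. -/
lemma poch_sub_ne_zero (hδ : ∀ k : ℤ, k ≠ 0 → br ((k : ℂ) * δ) ≠ 0) {X : ι → ℂ}
    (hX : ∀ i j, i ≠ j → ∀ k : ℤ, br (X i - X j + (k : ℂ) * δ) ≠ 0) (μ : ι → ℕ) (i j : ι) :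
    poch br δ (X i - X j - (μ j : ℂ) * δ) (μ i) ≠ 0 := by
  refine poch_ne_zero fun s hs => ?_
  by_cases hij : i = j
  · subst hij
    have := hδ ((s : ℤ) - μ i) (by omega)
    convert this using 2
    push_cast
    ring
  · have := hX i j hij ((s : ℤ) - μ j)
    convert this using 2
    push_cast
    ring

lemma clearedPair_shift {n : ℕ} {q u v : ℂ} {X Z : ι → ℂ} {μ ε η : ι → ℕ} {i j : ι}
    (hn : μ i + ε i ≤ n) (hu : X i - X j - ((μ j + ε j : ℕ) : ℂ) * δ = u) (hv : X i - Z j = v)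
    (h1 : poch br δ u (ε i) ≠ 0)
    (h2 : poch br δ (v + ((ε i + μ i : ℕ) : ℂ) * δ) (η j) ≠ 0)
    (h4 : poch br δ (q + v + (ε i : ℂ) * δ) (η j) ≠ 0)
    (h5 : poch br δ (q + v + (ε i : ℂ) * δ + (η j : ℂ) * δ) (μ i) ≠ 0) :
    clearedPair br δ n q X Z (fun i => μ i + ε i) i j
      = (poch br δ v (ε i + η j) * poch br δ (q + v + (ε i : ℂ) * δ) (n - ε i) /
            poch br δ (q + v + (ε i : ℂ) * δ) (η j)) *
          sourcePair br δ q (fun i => X i + (ε i : ℂ) * δ) (fun i => Z i - (η i : ℂ) * δ) μ i j *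
          (poch br δ (q + u) (ε i) / poch br δ u (ε i) *
            (poch br δ (q + v + ((ε i + μ i : ℕ) : ℂ) * δ) (η j) /
              poch br δ (v + ((ε i + μ i : ℕ) : ℂ) * δ) (η j))) := by
  unfold clearedPair sourcePair
  obtain ⟨b, rfl⟩ := Nat.exists_eq_add_of_le hn
  beta_reduce
  have e1 : q + X i - X j - ((μ j + ε j : ℕ) : ℂ) * δ = q + u := by rw [← hu]; ring
  have e2 : q + X i - Z j = q + v := by rw [← hv]; ring
  have e3 : q + (X i + (ε i : ℂ) * δ) - (X j + (ε j : ℂ) * δ) - (μ j : ℂ) * δ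
      = q + u + (ε i : ℂ) * δ := by rw [← hu]; push_cast; ring
  have e4 : X i + (ε i : ℂ) * δ - (X j + (ε j : ℂ) * δ) - (μ j : ℂ) * δ
      = u + (ε i : ℂ) * δ := by rw [← hu]; push_cast; ring
  have e5 : X i + (ε i : ℂ) * δ - (Z j - (η j : ℂ) * δ) = v + ((ε i + η j : ℕ) : ℂ) * δ := by
    rw [← hv]; push_cast; ring
  have e6 : q + (X i + (ε i : ℂ) * δ) - (Z j - (η j : ℂ) * δ)
      = q + v + (ε i : ℂ) * δ + (η j : ℂ) * δ := by
    rw [← hv]; ring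
  rw [hu, hv, e1, e2, e3, e4, e5, e6, add_comm (μ i) (ε i), Nat.add_sub_cancel_left,
    show ε i + μ i + b - ε i = μ i + b by omega]
  have f1 := poch_add (br := br) (δ := δ) v (ε i + μ i) (η j)
  rw [show ε i + μ i + η j = (ε i + η j) + μ i by omega, poch_add] at f1
  have f2 := poch_add (br := br) (δ := δ) (q + v + (ε i : ℂ) * δ) (μ i) (η j)
  rw [add_comm (μ i) (η j), poch_add, show q + v + (ε i : ℂ) * δ + (μ i : ℂ) * δ
    = q + v + ((ε i + μ i : ℕ) : ℂ) * δ by push_cast; ring] at f2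
  rw [poch_add u, poch_add (q + u), poch_add (q + v + (ε i : ℂ) * δ) (μ i) b,
    show q + v + (ε i : ℂ) * δ + (μ i : ℂ) * δ
    = q + v + ((ε i + μ i : ℕ) : ℂ) * δ by push_cast; ring]
  have g1 := eq_div_of_mul_eq h2 f1.symm
  rw [g1]
  generalize poch br δ (q + v + (ε i : ℂ) * δ) (μ i) = A at *
  generalize poch br δ (q + v + (ε i : ℂ) * δ) (η j) = A1 at *
  generalize poch br δ (q + v + (ε i : ℂ) * δ + (η j : ℂ) * δ) (μ i) = A2 at *
  generalize poch br δ (q + v + ((ε i + μ i : ℕ) : ℂ) * δ) (η j) = A3 at *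
  generalize poch br δ (v + ((ε i + μ i : ℕ) : ℂ) * δ) (η j) = A4 at *
  generalize poch br δ (u + (ε i : ℂ) * δ) (μ i) = A5 at *
  generalize poch br δ (v + ((ε i + η j : ℕ) : ℂ) * δ) (μ i) = A6 at *
  generalize poch br δ (q + u + (ε i : ℂ) * δ) (μ i) = A7 at *
  generalize poch br δ (q + v + ((ε i + μ i : ℕ) : ℂ) * δ) b = A8 at *
  by_cases h6 : A5 = 0
  · simp [h6]
  · field_simp
    linear_combination (poch br δ v (ε i + η j) * A6 * poch br δ (q + u) (ε i) * A7 * A8) * f2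

/-- The factor relating the residue of the source identity at a node to the source terms of lower
degree. -/
noncomputable def residuePair (br : ℂ → ℂ) (δ : ℂ) (n : ℕ) (q : ℂ) (X Z : ι → ℂ) (ε η : ι → ℕ)
    (i j : ι) : ℂ :=
  poch br δ (X i - Z j) (ε i + η j) * poch br δ (q + (X i - Z j) + (ε i : ℂ) * δ) (n - ε i) /
    poch br δ (q + (X i - Z j) + (ε i : ℂ) * δ) (η j)

lemma residuePair_swap {X Z : ι → ℂ} {n : ℕ} {q : ℂ} {ε η : ι → ℕ} {i j : ι}
    (hε : ε i ≤ n) (hη : η j ≤ n) (h : ε i = η j ∨ ε i = 0 ∨ η j = 0)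
    (h1 : ε i = 0 → poch br δ (q + (X i - Z j)) (η j) ≠ 0)
    (h2 : η j = 0 → poch br δ (q + (X i - Z j)) (ε i) ≠ 0) :
    residuePair br δ n q X Z ε η i j = residuePair br δ n q (-Z) (-X) η ε j i := by
  unfold residuePair
  have e : (-Z) j - (-X) i = X i - Z j := by simp only [Pi.neg_apply]; ring
  rw [e, add_comm (η j) (ε i)]
  rcases h with h | h | h
  · rw [h]
  · have h1 := h1 h
    obtain ⟨b, rfl⟩ := Nat.exists_eq_add_of_le hη
    rw [h, Nat.sub_zero, Nat.add_sub_cancel_left]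
    simp only [Nat.cast_zero, zero_mul, add_zero, zero_add, poch_zero]
    rw [poch_add (q + (X i - Z j))]
    field_simp
  · have h1 := h2 h
    obtain ⟨b, rfl⟩ := Nat.exists_eq_add_of_le hε
    rw [h, Nat.sub_zero, Nat.add_sub_cancel_left]
    simp only [Nat.cast_zero, zero_mul, add_zero, poch_zero]
    rw [poch_add (q + (X i - Z j))]
    field_simp

lemma clearedPair_eq_prod {X Z : ι → ℂ} {n : ℕ} {q : ℂ} {μ : ι → ℕ} {i j : ι} (h : μ i ≤ n) :
    clearedPair br δ n q X Z μ i j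
      = poch br δ (X i - Z j) (μ i) / poch br δ (X i - X j - (μ j : ℂ) * δ) (μ i) *
        ∏ s : Fin n, br (q + (if (s : ℕ) < μ i then X i - X j - (μ j : ℂ) * δ else X i - Z j) +
          ((s : ℕ) : ℂ) * δ) := by
  unfold clearedPair
  rw [← prod_fin_ite _ _ h]
  congr 1
  refine Finset.prod_congr rfl fun s _ => ?_
  split_ifs <;> ring_nf

lemma sum_fin_ite_lt (n a : ℕ) (h : a ≤ n) (z : ℂ) :
    ∑ s : Fin n, (if (s : ℕ) < a then z else 0) = a * z := by
  rw [Fin.sum_univ_eq_sum_range (fun s : ℕ => if s < a then z else 0) n, ← Finset.sum_filter]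
  have : (range n).filter (fun s => s < a) = range a := by
    ext s; simp; omega
  rw [this]
  simp

variable [Fintype ι] [DecidableEq ι]

lemma prod_reflect_eq_one (hodd : ∀ z : ℂ, br (-z) = -br z)
    (hδ : ∀ k : ℤ, k ≠ 0 → br ((k : ℂ) * δ) ≠ 0) {X Z : ι → ℂ} (hg : IsGenericPair br δ X Z)
    (i₀ j₀ : ι) (s : ℕ) (μ : ι → ℕ) :
    ∏ i, ∏ j,
      (poch br δ (Z j₀ - X i₀ - (s : ℂ) * δ + (X i - X j -
          ((μ j + Pi.single (M := fun _ => ℕ) i₀ (s + 1) j : ℕ) : ℂ) * δ))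
          (Pi.single (M := fun _ => ℕ) i₀ (s + 1) i) /
        poch br δ (X i - X j - ((μ j + Pi.single (M := fun _ => ℕ) i₀ (s + 1) j : ℕ) : ℂ) * δ)
          (Pi.single (M := fun _ => ℕ) i₀ (s + 1) i) *
      (poch br δ (Z j₀ - X i₀ - (s : ℂ) * δ + (X i - Z j) +
          ((Pi.single (M := fun _ => ℕ) i₀ (s + 1) i + μ i : ℕ) : ℂ) * δ)
          (Pi.single (M := fun _ => ℕ) j₀ (s + 1) j) /
        poch br δ (X i - Z j + ((Pi.single (M := fun _ => ℕ) i₀ (s + 1) i + μ i : ℕ) : ℂ) * δ)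
          (Pi.single (M := fun _ => ℕ) j₀ (s + 1) j))) = 1 := by
  simp only [Finset.prod_mul_distrib]
  rw [Finset.prod_eq_single i₀ (fun i _ hi => by simp [Pi.single_eq_of_ne hi]) (by simp)]
  rw [Finset.prod_congr rfl (fun i _ => Finset.prod_eq_single (f := fun j =>
    poch br δ (Z j₀ - X i₀ - (s : ℂ) * δ + (X i - Z j) +
          ((Pi.single (M := fun _ => ℕ) i₀ (s + 1) i + μ i : ℕ) : ℂ) * δ)
          (Pi.single (M := fun _ => ℕ) j₀ (s + 1) j) /
        poch br δ (X i - Z j + ((Pi.single (M := fun _ => ℕ) i₀ (s + 1) i + μ i : ℕ) : ℂ) * δ)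
          (Pi.single (M := fun _ => ℕ) j₀ (s + 1) j)) j₀
      (fun j _ hj => by simp [Pi.single_eq_of_ne hj]) (by simp))]
  simp only [Pi.single_eq_same]
  rw [← Finset.prod_mul_distrib]
  refine Finset.prod_eq_one fun k _ => ?_
  rw [add_comm (Pi.single (M := fun _ => ℕ) i₀ (s + 1) k) (μ k)]
  have hν : k = i₀ → s + 1 ≤ μ k + Pi.single (M := fun _ => ℕ) i₀ (s + 1) k := by
    rintro rfl
    simp
  generalize μ k + Pi.single (M := fun _ => ℕ) i₀ (s + 1) k = ν at hν ⊢
  have d1 : poch br δ (X i₀ - X k - (ν : ℂ) * δ) (s + 1) ≠ 0 := by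
    refine poch_ne_zero fun t ht => ?_
    by_cases hk : k = i₀
    · have := hδ ((t : ℤ) - ν) (by have := hν hk; omega)
      convert this using 2
      rw [hk]
      push_cast
      ring
    · have := hg.sub_left (Ne.symm hk) ((t : ℤ) - ν)
      convert this using 2
      push_cast
      ring
  have d2 : poch br δ (X k - Z j₀ + (ν : ℂ) * δ) (s + 1) ≠ 0 := by
    refine poch_ne_zero fun t ht => ?_
    have := hg.cross k j₀ ((t : ℤ) + ν)
    convert this using 2
    push_cast
    ring
  rw [poch_reflect hodd (Z j₀ - X i₀ - (s : ℂ) * δ + (X i₀ - X k - (ν : ℂ) * δ)),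
    poch_reflect hodd (Z j₀ - X i₀ - (s : ℂ) * δ + (X k - Z j₀) + (ν : ℂ) * δ)]
  have e1 : -(Z j₀ - X i₀ - (s : ℂ) * δ + (X i₀ - X k - (ν : ℂ) * δ)) -
      (((s + 1 : ℕ) : ℂ) - 1) * δ = X k - Z j₀ + (ν : ℂ) * δ := by push_cast; ring
  have e2 : -(Z j₀ - X i₀ - (s : ℂ) * δ + (X k - Z j₀) + (ν : ℂ) * δ) -
      (((s + 1 : ℕ) : ℂ) - 1) * δ = X i₀ - X k - (ν : ℂ) * δ := by push_cast; ring
  rw [e1, e2]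
  have e3 : ((-1 : ℂ) ^ (s + 1)) * (-1) ^ (s + 1) = 1 := by
    rw [← mul_pow]; simp
  field_simp
  linear_combination e3

lemma sum_clearedPair_node (hodd : ∀ z : ℂ, br (-z) = -br z)
    (hδ : ∀ k : ℤ, k ≠ 0 → br ((k : ℂ) * δ) ≠ 0) {X Z : ι → ℂ} (hg : IsGenericPair br δ X Z)
    (i₀ j₀ : ι) {n s : ℕ} (hs : s < n) {ε η : ι → ℕ} (hε : ε = Pi.single i₀ (s + 1))
    (hη : η = Pi.single j₀ (s + 1)) {q : ℂ} (hq : q = Z j₀ - X i₀ - (s : ℂ) * δ) :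
    ∑ μ ∈ Finset.piAntidiag univ n, ∏ i, ∏ j, clearedPair br δ n q X Z μ i j
      = (∏ i, ∏ j, residuePair br δ n q X Z ε η i j) *
        ∑ μ ∈ Finset.piAntidiag univ (n - (s + 1)),
          sourceTerm br δ q (fun i => X i + (ε i : ℂ) * δ) (fun i => Z i - (η i : ℂ) * δ) μ := by
  have hz : ∀ i j (k : ℤ), ((i, j) = (i₀, j₀) → k ≠ s) →
      br (q + (X i - Z j) + (k : ℂ) * δ) ≠ 0 := by
    intro i j k hk
    by_cases h : (i, j) = (i₀, j₀)
    · have := hδ (k - s) (by have := hk h; omega)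
      convert this using 2
      simp only [Prod.mk.injEq] at h
      rw [hq, h.1, h.2]
      push_cast
      ring
    · have := hg.pair i₀ j₀ i j (k - s) (Ne.symm h)
      convert this using 2
      rw [hq]
      push_cast
      ring
  rw [Finset.mul_sum]
  symm
  refine Finset.sum_of_injOn (fun μ => fun i => μ i + ε i) ?_ ?_ ?_ ?_
  · intro μ _ ν _ h
    funext i
    have := congrFun h i
    simpa using this
  · intro μ hμ
    simp only [mem_coe, Finset.mem_piAntidiag] at hμ ⊢
    refine ⟨?_, by simp⟩
    rw [Finset.sum_add_distrib, hμ.1, hε]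
    simp
    omega
  · intro μ hμ hn
    have hlt : μ i₀ < s + 1 := by
      by_contra hle
      apply hn
      refine ⟨fun i => μ i - ε i, ?_, ?_⟩
      · simp only [mem_coe, Finset.mem_piAntidiag] at hμ ⊢
        refine ⟨?_, by simp⟩
        have h2 : ∑ i, (μ i - ε i) + ∑ i, ε i = n := by
          rw [← Finset.sum_add_distrib, ← hμ.1]
          refine Finset.sum_congr rfl fun i _ => Nat.sub_add_cancel ?_
          rw [hε]
          by_cases hi : i = i₀
          · subst hi; simp; omega
          · simp [Pi.single_eq_of_ne hi]
        have h3 : ∑ i, ε i = s + 1 := by rw [hε]; simp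
        omega
      · funext i
        refine Nat.sub_add_cancel ?_
        rw [hε]
        by_cases hi : i = i₀
        · subst hi; simp; omega
        · simp [Pi.single_eq_of_ne hi]
    refine Finset.prod_eq_zero (Finset.mem_univ i₀) (Finset.prod_eq_zero (Finset.mem_univ j₀) ?_)
    unfold clearedPair
    refine mul_eq_zero_of_right _ (mul_eq_zero_of_right _ ?_)
    refine Finset.prod_eq_zero (i := s - μ i₀) (Finset.mem_range.2 (by omega)) ?_
    convert bracket_zero hodd using 2
    rw [hq, Nat.cast_sub (by omega)]
    ring
  · intro μ hμ
    simp only [Finset.mem_piAntidiag] at hμ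
    have hsum : ∀ i, μ i + ε i ≤ n := by
      intro i
      have h1 : μ i ≤ ∑ i, μ i := Finset.single_le_sum (fun _ _ => Nat.zero_le _) (mem_univ i)
      rw [hμ.1] at h1
      have h2 : ε i ≤ s + 1 := by
        rw [hε]
        by_cases hi : i = i₀
        · subst hi; simp
        · simp [Pi.single_eq_of_ne hi]
      omega
    have hεi : ∀ i, i = i₀ → ε i = s + 1 := by rintro i rfl; simp [hε]
    have hεi' : ∀ i, i ≠ i₀ → ε i = 0 := by intro i hi; simp [hε, Pi.single_eq_of_ne hi]
    rw [Finset.prod_congr rfl fun i _ => Finset.prod_congr rfl fun j _ =>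
      clearedPair_shift (η := η) (hsum i) rfl rfl ?_ ?_ ?_ ?_]
    · simp only [Finset.prod_mul_distrib]
      have := prod_reflect_eq_one hodd hδ hg i₀ j₀ s μ
      rw [← hε, ← hη, ← hq] at this
      simp only [Finset.prod_mul_distrib] at this
      rw [this, mul_one]
      rfl
    · refine poch_ne_zero fun t ht => ?_
      by_cases hij : i = j
      · have := hδ ((t : ℤ) - (μ j + ε j)) (by rw [hij] at ht; omega)
        convert this using 2
        rw [hij]
        push_cast
        ring
      · have := hg.sub_left hij ((t : ℤ) - (μ j + ε j))
        convert this using 2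
        push_cast
        ring
    · refine poch_ne_zero fun t ht => ?_
      have := hg.cross i j ((t : ℤ) + (ε i + μ i))
      convert this using 2
      push_cast
      ring
    · refine poch_ne_zero fun t ht => ?_
      have := hz i j ((t : ℤ) + ε i) (by
        intro h; have := hεi i (congrArg Prod.fst h); omega)
      convert this using 2
      push_cast
      ring
    · refine poch_ne_zero fun t ht => ?_
      have := hz i j ((t : ℤ) + ε i + η j) (by
        intro h; have := hεi i (congrArg Prod.fst h); omega)
      convert this using 2
      push_cast
      ring

lemma le_of_mem_piAntidiag {n : ℕ} {μ : ι → ℕ} (h : μ ∈ Finset.piAntidiag univ n) (i : ι) :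
    μ i ≤ n := by
  rw [← (Finset.mem_piAntidiag.1 h).1]
  exact Finset.single_le_sum (fun _ _ => Nat.zero_le _) (mem_univ i)

lemma sum_clearedPair_swap (hodd : ∀ z : ℂ, br (-z) = -br z) (hent : Differentiable ℂ br)
    (hnz : br ≠ 0)
    (hW : ∀ a b c d : ℂ,
      br (a + b) * br (a - b) * br (c + d) * br (c - d)
        + br (a + d) * br (a - d) * br (b + c) * br (b - c)
        = br (a + c) * br (a - c) * br (b + d) * br (b - d))
    {X Z : ι → ℂ} (hg : IsGenericPair br δ X Z) {n : ℕ} (hn : 1 ≤ n)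
    (hδ : ∀ k : ℤ, k ≠ 0 → br ((k : ℂ) * δ) ≠ 0)
    (hnode : ∀ i j : ι, ∀ s < n,
      ∑ μ ∈ Finset.piAntidiag univ n, ∏ i', ∏ j',
        clearedPair br δ n (Z j - X i - (s : ℂ) * δ) X Z μ i' j' =
      ∑ μ ∈ Finset.piAntidiag univ n, ∏ i', ∏ j',
        clearedPair br δ n (Z j - X i - (s : ℂ) * δ) (-Z) (-X) μ i' j') (q : ℂ) :
    ∑ μ ∈ Finset.piAntidiag univ n, ∏ i, ∏ j, clearedPair br δ n q X Z μ i j =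
      ∑ μ ∈ Finset.piAntidiag univ n, ∏ i, ∏ j, clearedPair br δ n q (-Z) (-X) μ i j := by
  let A := Finset.piAntidiag (univ : Finset ι) n
  let w : (ι → ℂ) → (ι → ℂ) → (ι → ℕ) → ℂ := fun X Z μ =>
    ∏ i, ∏ j, poch br δ (X i - Z j) (μ i) / poch br δ (X i - X j - (μ j : ℂ) * δ) (μ i)
  let c : (ι → ℂ) → (ι → ℂ) → (ι → ℕ) → ι → ι → Fin n → ℂ := fun X Z μ i j s =>
    (if (s : ℕ) < μ i then X i - X j - (μ j : ℂ) * δ else X i - Z j) + ((s : ℕ) : ℂ) * δ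
  have hform : ∀ (X Z : ι → ℂ), ∀ μ ∈ A, ∀ q, ∏ i, ∏ j, clearedPair br δ n q X Z μ i j
      = w X Z μ * ∏ p : ι × ι × Fin n, br (q + c X Z μ p.1 p.2.1 p.2.2) := by
    intro X Z μ hμ q
    rw [Finset.prod_congr rfl fun i _ => Finset.prod_congr rfl fun j _ =>
      clearedPair_eq_prod (le_of_mem_piAntidiag hμ i)]
    simp only [Finset.prod_mul_distrib, Fintype.prod_prod_type]
    simp only [w, c, add_assoc]
  have hform' : ∀ (X Z : ι → ℂ), ∀ μ ∈ A, ∀ q, ∏ i, ∏ j, clearedPair br δ n q X Z μ i j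
      = w X Z μ * ∏ p : ι × ι × Fin n, br (q + c X Z μ p.2.1 p.1 p.2.2) := by
    intro X Z μ hμ q
    rw [hform X Z μ hμ q]
    simp only [Fintype.prod_prod_type]
    rw [Finset.prod_comm]
  have main := sum_prod_bracket_eq_zero (ι := ι × ι × Fin n) hodd hent hnz hW (A.disjSum A)
    (Sum.elim (w X Z) (fun μ => - w (-Z) (-X) μ))
    (Sum.elim (fun μ p => c X Z μ p.1 p.2.1 p.2.2) (fun μ p => c (-Z) (-X) μ p.2.1 p.1 p.2.2))
    (fun p => Z p.2.1 - X p.1 - ((p.2.2 : ℕ) : ℂ) * δ)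
    ((n : ℂ) * ∑ i, (Z i - X i) + ((-(n * n) : ℤ) : ℂ) * δ) ?_ ?_ (hg.total n _ hn) ?_ q
  · rw [Finset.sum_disjSum] at main
    simp only [Sum.elim_inl, Sum.elim_inr, neg_mul, Finset.sum_neg_distrib] at main
    rw [Finset.sum_congr rfl fun μ hμ => hform X Z μ hμ q,
      Finset.sum_congr rfl fun μ hμ => hform' (-Z) (-X) μ hμ q]
    exact add_neg_eq_zero.1 main
  · intro a ha
    have key : ∀ μ ∈ A, ∑ i, ∑ j, ∑ s : Fin n,
        (if (s : ℕ) < μ i then Z j - X j - (μ j : ℂ) * δ else 0)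
        = (n : ℂ) * ∑ i, (Z i - X i) + ((-(n * n) : ℤ) : ℂ) * δ := by
      intro μ hμ
      have hs : (∑ i, (μ i : ℂ)) = n := by
        rw [← (Finset.mem_piAntidiag.1 hμ).1]; push_cast; rfl
      simp only [sum_fin_ite_lt n _ (le_of_mem_piAntidiag hμ _)]
      simp only [← Finset.mul_sum, ← Finset.sum_mul, Finset.sum_sub_distrib, hs]
      push_cast
      ring
    rcases a with μ | μ
    · have hμ : μ ∈ A := by simpa using ha
      rw [← key μ hμ]
      simp only [Fintype.sum_prod_type, Sum.elim_inl, c]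
      refine Finset.sum_congr rfl fun i _ => Finset.sum_congr rfl fun j _ =>
        Finset.sum_congr rfl fun s _ => ?_
      split_ifs <;> ring
    · have hμ : μ ∈ A := by simpa using ha
      rw [← key μ hμ, Finset.sum_comm]
      simp only [Fintype.sum_prod_type, Sum.elim_inr, c]
      refine Finset.sum_congr rfl fun i _ => Finset.sum_congr rfl fun j _ =>
        Finset.sum_congr rfl fun s _ => ?_
      simp only [Pi.neg_apply]
      split_ifs <;> ring
  · rintro ⟨i, j, s⟩ ⟨i', j', s'⟩ hne
    by_cases h : (i, j) = (i', j')
    · simp only [Prod.mk.injEq] at h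
      have hs : (s : ℕ) ≠ s' := by
        intro hs
        exact hne (by rw [h.1, h.2, Fin.ext hs])
      have := hδ ((s' : ℤ) - s) (by omega)
      convert this using 2
      simp only [h.1, h.2]
      push_cast
      ring
    · have := hg.pair i j i' j' ((s' : ℤ) - s) h
      convert this using 2
      push_cast
      ring
  · rintro ⟨i, j, s⟩
    rw [Finset.sum_disjSum]
    simp only [Sum.elim_inl, Sum.elim_inr, neg_mul, Finset.sum_neg_distrib]
    rw [add_neg_eq_zero]
    have := hnode i j s s.2
    rwa [Finset.sum_congr rfl fun μ hμ => hform X Z μ hμ _,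
      Finset.sum_congr rfl fun μ hμ => hform' (-Z) (-X) μ hμ _] at this

/-- The source identity at a generic point. -/
theorem sum_sourceTerm_swap_of_generic (hodd : ∀ z : ℂ, br (-z) = -br z)
    (hent : Differentiable ℂ br) (hnz : br ≠ 0)
    (hW : ∀ a b c d : ℂ,
      br (a + b) * br (a - b) * br (c + d) * br (c - d)
        + br (a + d) * br (a - d) * br (b + c) * br (b - c)
        = br (a + c) * br (a - c) * br (b + d) * br (b - d))
    (hδ : ∀ k : ℤ, k ≠ 0 → br ((k : ℂ) * δ) ≠ 0) (n : ℕ) {X Z : ι → ℂ}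
    (hg : IsGenericPair br δ X Z) (q : ℂ)
    (hq : ∀ i j, ∀ s < n, br (q + X i - Z j + (s : ℂ) * δ) ≠ 0) :
    ∑ μ ∈ Finset.piAntidiag univ n, sourceTerm br δ q X Z μ =
      ∑ μ ∈ Finset.piAntidiag univ n, sourceTerm br δ q (-Z) (-X) μ := by
  induction n using Nat.strong_induction_on generalizing X Z q with
  | _ n ih =>
  rcases Nat.eq_zero_or_pos n with rfl | hn
  · simp [sourceTerm, sourcePair]
  have hD : ∀ i j, poch br δ (q + X i - Z j) n ≠ 0 := fun i j => poch_ne_zero (hq i j)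
  have hD' : ∀ i j, poch br δ (q + (-Z) i - (-X) j) n ≠ 0 := by
    intro i j
    convert hD j i using 1
    simp only [Pi.neg_apply]
    ring_nf
  have hD0 : (∏ i, ∏ j, poch br δ (q + X i - Z j) n) ≠ 0 :=
    Finset.prod_ne_zero_iff.2 fun i _ => Finset.prod_ne_zero_iff.2 fun j _ => hD i j
  apply mul_right_cancel₀ hD0
  have key := sum_clearedPair_swap hodd hent hnz hW hg hn hδ ?_ q
  · rw [Finset.sum_mul, Finset.sum_mul]
    have e1 : ∀ μ ∈ Finset.piAntidiag (univ : Finset ι) n, sourceTerm br δ q X Z μ *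
        (∏ i, ∏ j, poch br δ (q + X i - Z j) n)
        = ∏ i, ∏ j, clearedPair br δ n q X Z μ i j := by
      intro μ hμ
      simp only [sourceTerm, ← Finset.prod_mul_distrib]
      exact Finset.prod_congr rfl fun i _ => Finset.prod_congr rfl fun j _ =>
        sourcePair_mul (le_of_mem_piAntidiag hμ i) (hD i j)
    have e2 : ∀ μ ∈ Finset.piAntidiag (univ : Finset ι) n, sourceTerm br δ q (-Z) (-X) μ *
        (∏ i, ∏ j, poch br δ (q + X i - Z j) n)
        = ∏ i, ∏ j, clearedPair br δ n q (-Z) (-X) μ i j := by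
      intro μ hμ
      rw [Finset.prod_comm]
      simp only [sourceTerm, ← Finset.prod_mul_distrib]
      refine Finset.prod_congr rfl fun i _ => Finset.prod_congr rfl fun j _ => ?_
      rw [← sourcePair_mul (le_of_mem_piAntidiag hμ i) (hD' i j)]
      congr 2
      simp only [Pi.neg_apply]
      ring
    rw [Finset.sum_congr rfl e1, Finset.sum_congr rfl e2, key]
  · intro i₀ j₀ s hs
    set ε : ι → ℕ := Pi.single i₀ (s + 1) with hε
    set η : ι → ℕ := Pi.single j₀ (s + 1) with hη
    set q₀ := Z j₀ - X i₀ - (s : ℂ) * δ with hq₀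
    rw [sum_clearedPair_node hodd hδ hg i₀ j₀ hs hε hη hq₀,
      sum_clearedPair_node hodd hδ hg.neg_swap j₀ i₀ hs hη hε
        (by rw [hq₀]; simp only [Pi.neg_apply]; ring)]
    have hεi : ∀ i, i = i₀ → ε i = s + 1 := by rintro i rfl; simp [hε]
    have hεi' : ∀ i, i ≠ i₀ → ε i = 0 := by intro i hi; simp [hε, Pi.single_eq_of_ne hi]
    have hηj : ∀ i, i = j₀ → η i = s + 1 := by rintro i rfl; simp [hη]
    have hηj' : ∀ i, i ≠ j₀ → η i = 0 := by intro i hi; simp [hη, Pi.single_eq_of_ne hi]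
    have hz : ∀ i j (k : ℤ), ((i, j) = (i₀, j₀) → k ≠ s) →
        br (q₀ + (X i - Z j) + (k : ℂ) * δ) ≠ 0 := by
      intro i j k hk
      by_cases h : (i, j) = (i₀, j₀)
      · have := hδ (k - s) (by have := hk h; omega)
        convert this using 2
        simp only [Prod.mk.injEq] at h
        rw [hq₀, h.1, h.2]
        push_cast
        ring
      · have := hg.pair i₀ j₀ i j (k - s) (Ne.symm h)
        convert this using 2
        rw [hq₀]
        push_cast
        ring
    congr 1
    · rw [Finset.prod_comm]
      refine Finset.prod_congr rfl fun j _ => Finset.prod_congr rfl fun i _ =>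
        residuePair_swap ?_ ?_ ?_ ?_ ?_
      · by_cases hi : i = i₀
        · rw [hεi i hi]; omega
        · rw [hεi' i hi]; omega
      · by_cases hj : j = j₀
        · rw [hηj j hj]; omega
        · rw [hηj' j hj]; omega
      · by_cases hi : i = i₀
        · by_cases hj : j = j₀
          · left; rw [hεi i hi, hηj j hj]
          · right; right; exact hηj' j hj
        · right; left; exact hεi' i hi
      · intro h
        refine poch_ne_zero fun t _ => ?_
        exact_mod_cast hz i j t (by
          intro h'; have := hεi i (congrArg Prod.fst h'); omega)
      · intro h
        refine poch_ne_zero fun t _ => ?_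
        exact_mod_cast hz i j t (by
          intro h'; have := hηj j (congrArg Prod.snd h'); omega)
    · have hg' := hg.shift (fun i => (ε i : ℤ)) (fun i => -(η i : ℤ))
      have e1 : (fun i => Z i + ((-(η i : ℤ) : ℤ) : ℂ) * δ) = fun i => Z i - (η i : ℂ) * δ := by
        funext i; push_cast; ring
      have e0 : (fun i => X i + ((ε i : ℤ) : ℂ) * δ) = fun i => X i + (ε i : ℂ) * δ := by
        funext i; push_cast; rfl
      rw [e0, e1] at hg'
      have := ih (n - (s + 1)) (by omega) hg' q₀ ?_
      · convert this using 3 with μ _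
        · funext i; simp only [Pi.neg_apply]; ring
        · funext i; simp only [Pi.neg_apply]; ring
      · intro i j t _
        have := hz i j ((ε i : ℤ) + η j + t) (by
          intro h'; have := hεi i (congrArg Prod.fst h'); omega)
        convert this using 2
        push_cast
        ring

end SourceIdentity

section Density

open Filter Topology

variable {br : ℂ → ℂ}

lemma eventually_residual_bracket_ne_zero (hent : Differentiable ℂ br) (hnz : br ≠ 0) {E : Type*}
    [NormedAddCommGroup E] [NormedSpace ℂ E] {f : E → ℂ} (hf : Continuous f) (v : E) {a : ℂ}
    (ha : a ≠ 0) (hv : ∀ (p : E) (t : ℂ), f (p + t • v) = f p + t * a) :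
    ∀ᶠ p in residual E, br (f p) ≠ 0 := by
  refine residual_of_dense_open ((hent.continuous.comp hf).isOpen_preimage {0}ᶜ
    isOpen_compl_singleton) ?_
  intro p
  have hd : Dense {t : ℂ | br (f p + t * a) ≠ 0} := by
    have := (dense_bracket_ne_zero hent hnz).preimage
      ((Homeomorph.mulRight₀ a ha).trans (Homeomorph.addLeft (f p))).isOpenMap
    exact this
  have hc : Continuous fun t : ℂ => p + t • v := by fun_prop
  have h0 := hc.closure_preimage_subset {p | br (f p) ≠ 0}
  have : (0 : ℂ) ∈ closure ((fun t : ℂ => p + t • v) ⁻¹' {p | br (f p) ≠ 0}) := by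
    convert hd 0 using 2
    ext t
    simp [hv]
  simpa using h0 this

lemma eq_of_residual {E : Type*} [NormedAddCommGroup E] [CompleteSpace E] {f g : E → ℂ} {p : E}
    {P : E → Prop} (hP : ∀ᶠ z in residual E, P z) (hf : ContinuousAt f p) (hg : ContinuousAt g p)
    (h : ∀ᶠ z in 𝓝 p, P z → f z = g z) : f p = g p := by
  have hd : Dense {z | P z} := dense_of_mem_residual hP
  have hfr : ∃ᶠ z in 𝓝 p, P z := mem_closure_iff_frequently.1 (hd p)
  exact tendsto_nhds_unique_of_frequently_eq hf hg
    ((hfr.and_eventually h).mono fun z hz => hz.2 hz.1)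

lemma continuous_poch (hc : Continuous br) (δ : ℂ) (k : ℕ) :
    Continuous fun u => poch br δ u k := by
  unfold poch
  fun_prop

variable {ι : Type*} [Fintype ι] {δ : ℂ}

lemma eventually_isGenericPair [DecidableEq ι] [Nonempty ι] (hent : Differentiable ℂ br) (hnz : br ≠ 0) :
    ∀ᶠ p : (ι → ℂ) × (ι → ℂ) in residual _, IsGenericPair br δ p.1 p.2 := by
  have h1 : ∀ᶠ p : (ι → ℂ) × (ι → ℂ) in residual _, ∀ (i j i' j' : ι) (k : ℤ),
      (i, j) ≠ (i', j') → br (p.2 j - p.1 i - (p.2 j' - p.1 i') + (k : ℂ) * δ) ≠ 0 := by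
    simp only [eventually_countable_forall]
    intro i j i' j' k hne
    by_cases hi : i = i'
    · have hj : j ≠ j' := by rintro rfl; exact hne (by rw [hi])
      refine eventually_residual_bracket_ne_zero hent hnz
        (f := fun p : (ι → ℂ) × (ι → ℂ) => p.2 j - p.1 i - (p.2 j' - p.1 i') + (k : ℂ) * δ)
        (by fun_prop) (0, Pi.single j 1) one_ne_zero fun p t => ?_
      simp [Pi.single_eq_of_ne hj.symm]
      ring
    · refine eventually_residual_bracket_ne_zero hent hnz
        (f := fun p : (ι → ℂ) × (ι → ℂ) => p.2 j - p.1 i - (p.2 j' - p.1 i') + (k : ℂ) * δ)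
        (by fun_prop) (Pi.single i 1, 0) (neg_ne_zero.2 one_ne_zero) fun p t => ?_
      simp [Pi.single_eq_of_ne (Ne.symm hi)]
      ring
  have h2 : ∀ᶠ p : (ι → ℂ) × (ι → ℂ) in residual _, ∀ (i j : ι) (k : ℤ),
      br (p.1 i - p.2 j + (k : ℂ) * δ) ≠ 0 := by
    simp only [eventually_countable_forall]
    intro i j k
    refine eventually_residual_bracket_ne_zero hent hnz
      (f := fun p : (ι → ℂ) × (ι → ℂ) => p.1 i - p.2 j + (k : ℂ) * δ)
      (by fun_prop) (Pi.single i 1, 0) one_ne_zero fun p t => ?_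
    simp
    ring
  have h3 : ∀ᶠ p : (ι → ℂ) × (ι → ℂ) in residual _, ∀ (n : ℕ) (k : ℤ), 1 ≤ n →
      br ((n : ℂ) * ∑ i, (p.2 i - p.1 i) + (k : ℂ) * δ) ≠ 0 := by
    simp only [eventually_countable_forall]
    intro n k hn
    obtain ⟨i₀⟩ := ‹Nonempty ι›
    refine eventually_residual_bracket_ne_zero hent hnz
      (f := fun p : (ι → ℂ) × (ι → ℂ) => (n : ℂ) * ∑ i, (p.2 i - p.1 i) + (k : ℂ) * δ)
      (by fun_prop) (0, Pi.single i₀ 1) (a := n) (by exact_mod_cast (by omega)) fun p t => ?_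
    simp [Finset.sum_add_distrib, Pi.single_apply]
    ring
  filter_upwards [h1, h2, h3] with p a b c using ⟨a, b, c⟩

lemma continuousAt_sourceTerm {T : Type*} [TopologicalSpace T] {X Z : T → ι → ℂ}
    {μ : ι → ℕ} {q : ℂ} {t : T} (hc : Continuous br) (hX : Continuous X) (hZ : Continuous Z)
    (h1 : ∀ i j, poch br δ (X t i - X t j - (μ j : ℂ) * δ) (μ i) ≠ 0)
    (h2 : ∀ i j, poch br δ (q + X t i - Z t j) (μ i) ≠ 0) :
    ContinuousAt (fun t => sourceTerm br δ q (X t) (Z t) μ) t := by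
  unfold sourceTerm sourcePair
  have hp := fun k => continuous_poch hc δ k
  refine tendsto_finsetProd _ fun i _ => tendsto_finsetProd _ fun j _ => ?_
  refine ContinuousAt.div (Continuous.continuousAt ?_) (Continuous.continuousAt ?_)
    (mul_ne_zero (h1 i j) (h2 i j))
  · exact ((hp _).comp (by fun_prop)).mul ((hp _).comp (by fun_prop))
  · exact ((hp _).comp (by fun_prop)).mul ((hp _).comp (by fun_prop))

/-- The source identity. -/
theorem sum_sourceTerm_swap [DecidableEq ι] (hodd : ∀ z : ℂ, br (-z) = -br z)
    (hent : Differentiable ℂ br) (hnz : br ≠ 0)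
    (hW : ∀ a b c d : ℂ,
      br (a + b) * br (a - b) * br (c + d) * br (c - d)
        + br (a + d) * br (a - d) * br (b + c) * br (b - c)
        = br (a + c) * br (a - c) * br (b + d) * br (b - d))
    (hδ : ∀ k : ℤ, k ≠ 0 → br ((k : ℂ) * δ) ≠ 0) (n : ℕ) {X Z : ι → ℂ}
    (hX : ∀ i j, i ≠ j → ∀ k : ℤ, br (X i - X j + (k : ℂ) * δ) ≠ 0)
    (hZ : ∀ i j, i ≠ j → ∀ k : ℤ, br (Z i - Z j + (k : ℂ) * δ) ≠ 0) (q : ℂ)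
    (hq : ∀ i j, ∀ s < n, br (q + X i - Z j + (s : ℂ) * δ) ≠ 0) :
    ∑ μ ∈ Finset.piAntidiag univ n, sourceTerm br δ q X Z μ =
      ∑ μ ∈ Finset.piAntidiag univ n, sourceTerm br δ q (-Z) (-X) μ := by
  rcases isEmpty_or_nonempty ι with hι | hι
  · simp [sourceTerm]
  have hc := hent.continuous
  have hZ' : ∀ i j, i ≠ j → ∀ k : ℤ, br ((-Z) i - (-Z) j + (k : ℂ) * δ) ≠ 0 := by
    intro i j hij k
    convert hZ j i hij.symm k using 2
    simp only [Pi.neg_apply]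
    ring
  refine eq_of_residual (E := (ι → ℂ) × (ι → ℂ)) (p := (X, Z))
    (f := fun p => ∑ μ ∈ Finset.piAntidiag univ n, sourceTerm br δ q p.1 p.2 μ)
    (g := fun p => ∑ μ ∈ Finset.piAntidiag univ n, sourceTerm br δ q (-p.2) (-p.1) μ)
    (eventually_isGenericPair (δ := δ) hent hnz) ?_ ?_ ?_
  · refine tendsto_finsetSum _ fun μ hμ => continuousAt_sourceTerm hc continuous_fst
      continuous_snd (poch_sub_ne_zero hδ hX μ) fun i j => poch_ne_zero fun s hs => ?_
    exact hq i j s (hs.trans_le (le_of_mem_piAntidiag hμ i))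
  · refine tendsto_finsetSum _ fun μ hμ => continuousAt_sourceTerm hc continuous_snd.neg
      continuous_fst.neg (poch_sub_ne_zero hδ hZ' μ) fun i j => poch_ne_zero fun s hs => ?_
    convert hq j i s (hs.trans_le (le_of_mem_piAntidiag hμ i)) using 2
    simp only [Pi.neg_apply]
    ring
  · have : ∀ᶠ p : (ι → ℂ) × (ι → ℂ) in 𝓝 (X, Z), ∀ i j, ∀ s ∈ range n,
        br (q + p.1 i - p.2 j + (s : ℂ) * δ) ≠ 0 := by
      simp only [eventually_all, eventually_all_finset]
      intro i j s hs
      have hcont : Continuous fun p : (ι → ℂ) × (ι → ℂ) =>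
        br (q + p.1 i - p.2 j + (s : ℂ) * δ) := by fun_prop
      exact hcont.continuousAt.eventually_ne (hq i j s (mem_range.1 hs))
    filter_upwards [this] with p hp hg
    exact sum_sourceTerm_swap_of_generic hodd hent hnz hW hδ n hg q
      fun i j s hs => hp i j s (mem_range.2 hs)

end Density

section PairIdentities

variable {br : ℂ → ℂ} {δ κ u : ℂ}

/-- The point `u + nδ + lκ`. -/
def latticePt (u δ κ : ℂ) (n l : ℤ) : ℂ := u + (n : ℂ) * δ + (l : ℂ) * κ

/-- If no bracket vanishes on `u + ℤδ + ℤκ`, then all shifted factorials on this lattice are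
quotients of values of a single nowhere vanishing function. -/
lemma exists_lattice_gamma (hodd : ∀ z : ℂ, br (-z) = -br z)
    (h : ∀ n l : ℤ, br (latticePt u δ κ n l) ≠ 0) :
    ∃ G : ℤ → ℤ → ℂ, (∀ l n, G l n ≠ 0) ∧
      (∀ n l k, poch br δ (latticePt u δ κ n l) k = G l (n + (k : ℤ)) / G l n) ∧
      (∀ n l k, poch br (-δ) (latticePt u δ κ n l) k = G l (n + 1) / G l (n + 1 - (k : ℤ))) ∧
      (∀ n l k, poch br δ (-latticePt u δ κ n l) k
        = (-1) ^ k * (G l (n + 1) / G l (n + 1 - (k : ℤ)))) := by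
  have hpos : ∀ l (a b : ℤ) (k : ℕ), b = a + k →
      poch br δ (latticePt u δ κ a l) k ≠ 0 := fun l a b k _ =>
    poch_ne_zero fun s _ => by
      convert h (a + s) l using 2
      simp only [latticePt]
      push_cast
      ring
  let G : ℤ → ℤ → ℂ := fun l n =>
    poch br δ (latticePt u δ κ 0 l) n.toNat / poch br δ (latticePt u δ κ n l) (-n).toNat
  have hG : ∀ l n, G l n ≠ 0 := fun l n =>
    div_ne_zero (hpos l 0 _ _ rfl) (hpos l n _ _ rfl)
  have hstep : ∀ l n, G l (n + 1) = G l n * br (latticePt u δ κ n l) := by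
    intro l n
    rcases le_or_gt 0 n with hn | hn
    · obtain ⟨a, rfl⟩ := Int.eq_ofNat_of_zero_le hn
      have e1 : ((a : ℤ) + 1).toNat = a + 1 := by omega
      have e2 : (-((a : ℤ) + 1)).toNat = 0 := by omega
      have e3 : (-(a : ℤ)).toNat = 0 := by omega
      simp only [G, e1, e2, e3, poch_zero, div_one, poch_succ, Int.toNat_natCast]
      congr 2
      simp only [latticePt]
      push_cast
      ring
    · obtain ⟨a, ha⟩ : ∃ a : ℕ, n = -((a : ℤ) + 1) := ⟨(-n - 1).toNat, by omega⟩
      have e1 : (n + 1).toNat = 0 := by omega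
      have e2 : (-(n + 1)).toNat = a := by omega
      have e3 : (-n).toNat = 1 + a := by omega
      have e4 : n.toNat = 0 := by omega
      have e5 : latticePt u δ κ n l + ((1 : ℕ) : ℂ) * δ = latticePt u δ κ (n + 1) l := by
        simp only [latticePt]
        push_cast
        ring
      simp only [G, e1, e2, e3, e4, poch_zero, poch_add, e5, poch_one]
      have := h n l
      field_simp
  have h1 : ∀ n l k, poch br δ (latticePt u δ κ n l) k = G l (n + (k : ℤ)) / G l n := by
    intro n l k
    induction k with
    | zero => simp [hG]
    | succ k ih =>
      rw [poch_succ, ih, Nat.cast_succ, ← add_assoc, hstep, div_mul_eq_mul_div]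
      congr 3
      simp only [latticePt]
      push_cast
      ring
  have h3 : ∀ n l k, poch br δ (-latticePt u δ κ n l) k
      = (-1) ^ k * (G l (n + 1) / G l (n + 1 - (k : ℤ))) := by
    intro n l k
    rw [poch_reflect hodd]
    have := h1 (n + 1 - k) l k
    rw [sub_add_cancel] at this
    rw [← this]
    congr 2
    simp only [latticePt]
    push_cast
    ring
  refine ⟨G, hG, h1, fun n l k => ?_, h3⟩
  rw [← neg_neg (latticePt u δ κ n l), poch_neg_neg hodd, h3, ← mul_assoc, ← mul_pow]
  simp

lemma opPair_xx (hodd : ∀ z : ℂ, br (-z) = -br z)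
    (h : ∀ n l : ℤ, br (latticePt u δ κ n l) ≠ 0) {p r s P R S : ℕ} (hi : p = 0 ∨ s = 0)
    (hj : P = 0 ∨ S = 0) :
    poch br δ (latticePt u δ κ 0 1) (p + r) / poch br δ (latticePt u δ κ (-(P + R)) 0) (p + r) *
      (poch br (-δ) (latticePt u δ κ (p + r - P - R) (-1)) (s + r) /
        poch br (-δ) (latticePt u δ κ (p + r - P + S) 0) (s + r))
    = (-1) ^ (p + s) * (poch br δ (-latticePt u δ κ (-(P + R)) (-1)) s /
        poch br δ (latticePt u δ κ (p + r) 1) S) *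
      (poch br δ (latticePt u δ κ (p + r - P + 1) 0) P /
        poch br δ (-latticePt u δ κ (-(P + R - p + 1)) 0) p) *
      (poch br δ (latticePt u δ κ 0 1) (p + S) /
        poch br δ (latticePt u δ κ (p - s - P + S + 1) 0) (s + P)) *
      (poch br δ (latticePt u δ κ (p - P - R + 1) (-1)) r *
        poch br δ (latticePt u δ κ (p + S) 1) r /
        (poch br δ (latticePt u δ κ (p - P - R) 0) r *
          poch br δ (latticePt u δ κ (p + S + 1) 0) r)) := by
  obtain ⟨G, hG, h1, h2, h3⟩ := exists_lattice_gamma hodd h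
  simp only [h1, h2, h3]
  have hp : ((-1 : ℂ) ^ p) ^ 2 = 1 := by rw [← pow_mul, mul_comm, pow_mul]; simp
  push_cast
  rcases hi with rfl | rfl <;> rcases hj with rfl | rfl <;>
  · simp only [Nat.cast_zero, add_zero, zero_add, sub_zero, zero_sub, pow_zero, one_mul]
    ring_nf
    field_simp [hG]
    first | done | rw [hp] | (rw [mul_comm, pow_mul]; simp)

/-- The three parts `p`, `r`, `s` of the exponents of a variable which is shifted at most once. -/
def IsOdd (p r s : ℕ) : Prop :=
  (p = 0 ∧ r = 0 ∧ s = 0) ∨ (p = 1 ∧ r = 0 ∧ s = 0) ∨ (p = 0 ∧ r = 1 ∧ s = 0) ∨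
    (p = 0 ∧ r = 0 ∧ s = 1)

lemma opPair_xy (hodd : ∀ z : ℂ, br (-z) = -br z)
    (h : ∀ n l : ℤ, br (latticePt u δ κ n l) ≠ 0) {p r s P R S : ℕ} (hi : p = 0 ∨ s = 0)
    (hj : IsOdd P R S) :
    poch br δ (latticePt u δ κ (-1) 0) (p + r) / poch br δ (latticePt u δ κ (-(P + R)) 0) (p + r) *
      (poch br (-δ) (latticePt u δ κ (p + r) (P + R - 1)) (s + r) /
        poch br (-δ) (latticePt u δ κ (p + r - 1 + S + R) (P + R - 1)) (s + r))
    = (-1) ^ (p + s) * (poch br δ (-latticePt u δ κ (-(P + R)) (-1)) s /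
        poch br δ (latticePt u δ κ (p + r - 1) 0) S) *
      (poch br δ (latticePt u δ κ (p + r - P + 1) 0) P /
        poch br δ (-latticePt u δ κ (-(P + R - p + 1)) 0) p) *
      (poch br δ (latticePt u δ κ (-1) 0) (p + S) /
        (poch br δ (latticePt u δ κ (p - s + S) (-1)) s *
          poch br δ (latticePt u δ κ (p - s) 0) P)) *
      (poch br δ (latticePt u δ κ (p - P - R + 1) (-1)) r *
        poch br δ (latticePt u δ κ (p + S - 1) 0) r /
        (poch br δ (latticePt u δ κ (p - P - R) 0) r *
          poch br δ (latticePt u δ κ (p + S) (-1)) r)) := by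
  obtain ⟨G, hG, h1, h2, h3⟩ := exists_lattice_gamma hodd h
  simp only [h1, h2, h3]
  have hp : ((-1 : ℂ) ^ p) ^ 2 = 1 := by rw [← pow_mul, mul_comm, pow_mul]; simp
  push_cast
  rcases hi with rfl | rfl <;>
    rcases hj with ⟨rfl, rfl, rfl⟩ | ⟨rfl, rfl, rfl⟩ | ⟨rfl, rfl, rfl⟩ | ⟨rfl, rfl, rfl⟩ <;>
  · simp only [Nat.cast_zero, Nat.cast_one, add_zero, zero_add, sub_zero, zero_sub, pow_zero,
      one_mul]
    ring_nf
    field_simp [hG]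
    first | done | rw [hp] | (rw [mul_comm, pow_mul]; simp)

lemma opPair_yx (hodd : ∀ z : ℂ, br (-z) = -br z)
    (h : ∀ n l : ℤ, br (latticePt u δ κ n l) ≠ 0) {p r s P R S : ℕ} (hi : IsOdd p r s)
    (hj : P = 0 ∨ S = 0) :
    poch br δ (latticePt u δ κ 0 1) (p + r) / poch br δ (latticePt u δ κ (-(P + R)) 0) (p + r) *
      (poch br (-δ) (latticePt u δ κ (1 - P - R) (-p - r)) (s + r) /
        poch br (-δ) (latticePt u δ κ (1 - P + S) (1 - p - r)) (s + r))
    = (-1) ^ (p + s) * (poch br δ (-latticePt u δ κ (1 - P - R) 0) s /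
        poch br δ (latticePt u δ κ (p + r) 1) S) *
      (poch br δ (latticePt u δ κ (p + r - P + 1) 0) P /
        poch br δ (-latticePt u δ κ (-(P + R - p + 1)) 0) p) *
      (poch br δ (latticePt u δ κ 0 1) (p + S) /
        (poch br δ (latticePt u δ κ (p + 1 - P + S) 0) P *
          poch br δ (latticePt u δ κ (1 - P + S) 1) s)) *
      (poch br δ (latticePt u δ κ (p - P - R + 1) (-1)) r *
        poch br δ (latticePt u δ κ (p + S) 1) r /
        (poch br δ (latticePt u δ κ (p - P - R) 0) r *
          poch br δ (latticePt u δ κ (p + S + 1) 0) r)) := by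
  obtain ⟨G, hG, h1, h2, h3⟩ := exists_lattice_gamma hodd h
  simp only [h1, h2, h3]
  push_cast
  rcases hj with rfl | rfl <;>
    rcases hi with ⟨rfl, rfl, rfl⟩ | ⟨rfl, rfl, rfl⟩ | ⟨rfl, rfl, rfl⟩ | ⟨rfl, rfl, rfl⟩ <;>
  · simp only [Nat.cast_zero, Nat.cast_one, add_zero, zero_add, sub_zero, zero_sub, pow_zero,
      one_mul]
    ring_nf
    field_simp [hG]

lemma opPair_yy (hodd : ∀ z : ℂ, br (-z) = -br z)
    (h : ∀ n l : ℤ, br (latticePt u δ κ n l) ≠ 0) {p r s P R S : ℕ} (hi : IsOdd p r s)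
    (hj : IsOdd P R S) :
    poch br δ (latticePt u δ κ (-1) 0) (p + r) / poch br δ (latticePt u δ κ (-(P + R)) 0) (p + r) *
      (poch br (-δ) (latticePt u δ κ 1 (P + R - p - r)) (s + r) /
        poch br (-δ) (latticePt u δ κ (S + R) (P + R - p - r)) (s + r))
    = (-1) ^ (p + s) * (poch br δ (-latticePt u δ κ (1 - P - R) 0) s /
        poch br δ (latticePt u δ κ (p + r - 1) 0) S) *
      (poch br δ (latticePt u δ κ (p + r - P + 1) 0) P /
        poch br δ (-latticePt u δ κ (-(P + R - p + 1)) 0) p) *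
      (poch br δ (latticePt u δ κ (-1) 0) (p + S) / poch br δ (latticePt u δ κ p 0) P *
        (poch br δ (latticePt u δ κ 1 P) s /
          (poch br δ (latticePt u δ κ S P) s *
            poch br δ (latticePt u δ κ (1 - P) 0) s))) *
      (poch br δ (latticePt u δ κ (p - P - R + 1) (-1)) r *
        poch br δ (latticePt u δ κ (p + S - 1) 0) r /
        (poch br δ (latticePt u δ κ (p - P - R) 0) r *
          poch br δ (latticePt u δ κ (p + S) (-1)) r)) := by
  obtain ⟨G, hG, h1, h2, h3⟩ := exists_lattice_gamma hodd h
  simp only [h1, h2, h3]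
  push_cast
  rcases hj with ⟨rfl, rfl, rfl⟩ | ⟨rfl, rfl, rfl⟩ | ⟨rfl, rfl, rfl⟩ | ⟨rfl, rfl, rfl⟩ <;>
    rcases hi with ⟨rfl, rfl, rfl⟩ | ⟨rfl, rfl, rfl⟩ | ⟨rfl, rfl, rfl⟩ | ⟨rfl, rfl, rfl⟩ <;>
  · simp only [Nat.cast_zero, Nat.cast_one, add_zero, zero_add, sub_zero, zero_sub, pow_zero,
      one_mul]
    ring_nf
    field_simp [hG]

end PairIdentities

section OperatorCoefficients

variable {br : ℂ → ℂ} {δ κ : ℂ} {α β : Type*}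

/-- The parameters `d` attached to the two kinds of variables. -/
def dvec (δ κ : ℂ) : α ⊕ β → ℂ := Sum.elim (fun _ => -κ) (fun _ => δ)

/-- The step lengths attached to the two kinds of variables. -/
def gvec (δ κ : ℂ) : α ⊕ β → ℂ := Sum.elim (fun _ => δ) (fun _ => -κ)

/-- The factor of an operator coefficient attached to a pair of variables. -/
noncomputable def opPair (br : ℂ → ℂ) (δ κ : ℂ) (X : α ⊕ β → ℂ) (M : α ⊕ β → ℕ)
    (i j : α ⊕ β) : ℂ :=
  poch br δ (X i - X j - dvec δ κ j) (M i) / poch br δ (X i - X j - (M j : ℂ) * δ) (M i)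

/-- The ratio of a composite operator coefficient and a term of the source identity,
up to gauge factors. -/
noncomputable def ratioPair (br : ℂ → ℂ) (δ κ : ℂ) (X : α ⊕ β → ℂ) (p s : α ⊕ β → ℕ) :
    α ⊕ β → α ⊕ β → ℂ
  | .inl i, .inl j => poch br δ (X (.inl i) - X (.inl j) + κ) (p (.inl i) + s (.inl j)) /
      poch br δ (X (.inl i) - X (.inl j) + ((p (.inl i) : ℂ) - s (.inl i) - p (.inl j) +
        s (.inl j) + 1) * δ) (s (.inl i) + p (.inl j))
  | .inl i, .inr j => poch br δ (X (.inl i) - X (.inr j) - δ) (p (.inl i) + s (.inr j)) /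
      (poch br δ (X (.inl i) - X (.inr j) - κ + ((p (.inl i) : ℂ) - s (.inl i) +
        s (.inr j)) * δ) (s (.inl i)) *
      poch br δ (X (.inl i) - X (.inr j) + ((p (.inl i) : ℂ) - s (.inl i)) * δ) (p (.inr j)))
  | .inr i, .inl j => poch br δ (X (.inr i) - X (.inl j) + κ) (p (.inr i) + s (.inl j)) /
      (poch br δ (X (.inr i) - X (.inl j) + ((p (.inr i) : ℂ) + 1 - p (.inl j) +
        s (.inl j)) * δ) (p (.inl j)) *
      poch br δ (X (.inr i) - X (.inl j) + κ + (1 - (p (.inl j) : ℂ) + s (.inl j)) * δ)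
        (s (.inr i)))
  | .inr i, .inr j => poch br δ (X (.inr i) - X (.inr j) - δ) (p (.inr i) + s (.inr j)) /
      poch br δ (X (.inr i) - X (.inr j) + (p (.inr i) : ℂ) * δ) (p (.inr j)) *
      (poch br δ (X (.inr i) - X (.inr j) + (p (.inr j) : ℂ) * κ + δ) (s (.inr i)) /
        (poch br δ (X (.inr i) - X (.inr j) + (p (.inr j) : ℂ) * κ + (s (.inr j) : ℂ) * δ)
          (s (.inr i)) *
        poch br δ (X (.inr i) - X (.inr j) + (1 - (p (.inr j) : ℂ)) * δ) (s (.inr i))))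

/-- Points in general position with respect to the lattice of shifts. -/
structure IsGeneric (br : ℂ → ℂ) (δ κ : ℂ) (X : α ⊕ β → ℂ) : Prop where
  pair : ∀ i j, i ≠ j → ∀ n l : ℤ, br (latticePt (X i - X j) δ κ n l) ≠ 0
  self : ∀ n l : ℤ, n ≠ 0 ∨ l ≠ 0 → br (latticePt 0 δ κ n l) ≠ 0

/-- Exponents `p + ρ` and `s + ρ` with minimum `ρ`, admissible for the operators. -/
structure IsValid (p ρ s : α ⊕ β → ℕ) : Prop where
  inl : ∀ a, p (.inl a) = 0 ∨ s (.inl a) = 0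
  inr : ∀ b, IsOdd (p (.inr b)) (ρ (.inr b)) (s (.inr b))

noncomputable def gaugeA (br : ℂ → ℂ) (δ κ : ℂ) (X : α ⊕ β → ℂ) (p ρ s : α ⊕ β → ℕ)
    (i j : α ⊕ β) : ℂ :=
  poch br δ (X i - X j - dvec δ κ j + ((p i : ℂ) + ρ i) * δ) (s j)

noncomputable def gaugeB (br : ℂ → ℂ) (δ : ℂ) (X : α ⊕ β → ℂ) (p ρ : α ⊕ β → ℕ)
    (i j : α ⊕ β) : ℂ :=
  poch br δ (X i - X j + ((p i : ℂ) + ρ i - p j + 1) * δ) (p j)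

lemma gaugeA_ne_zero {X : α ⊕ β → ℂ} {p ρ s : α ⊕ β → ℕ} (hX : IsGeneric br δ κ X)
    (hv : IsValid p ρ s) (i j : α ⊕ β) : gaugeA br δ κ X p ρ s i j ≠ 0 := by
  refine poch_ne_zero fun t ht => ?_
  rcases eq_or_ne i j with rfl | hij
  · rcases i with a | b
    · convert hX.self (p (.inl a) + ρ (.inl a) + t) 1 (by simp) using 2
      simp [latticePt, dvec]
      ring
    · have h0 : p (.inr b) = 0 ∧ ρ (.inr b) = 0 ∧ t = 0 := by
        rcases hv.inr b with h | h | h | h <;> omega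
      convert hX.self (-1) 0 (by simp) using 2
      simp [latticePt, dvec, h0]
  · rcases j with a | b
    · convert hX.pair i _ hij (p i + ρ i + t) 1 using 2
      simp [latticePt, dvec]
      ring
    · convert hX.pair i _ hij (p i + ρ i + t - 1) 0 using 2
      simp [latticePt, dvec]
      ring

lemma gaugeB_ne_zero {X : α ⊕ β → ℂ} {p ρ : α ⊕ β → ℕ} (hX : IsGeneric br δ κ X)
    (i j : α ⊕ β) : gaugeB br δ X p ρ i j ≠ 0 := by
  refine poch_ne_zero fun t ht => ?_
  rcases eq_or_ne i j with rfl | hij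
  · convert hX.self (ρ i + 1 + t) 0 (by omega) using 2
    simp [latticePt]
    ring
  · convert hX.pair i _ hij (p i + ρ i - p j + 1 + t) 0 using 2
    simp [latticePt]
    ring

/-- Diagonal factors for the variables of the first kind. -/
lemma opPair_diag (hodd : ∀ z : ℂ, br (-z) = -br z)
    (h : ∀ n l : ℤ, n ≠ 0 ∨ l ≠ 0 → br (latticePt 0 δ κ n l) ≠ 0) {p r s : ℕ}
    (hi : p = 0 ∨ s = 0) :
    poch br δ κ (p + r) / poch br δ (-((p : ℂ) + r) * δ) (p + r) *
      (poch br (-δ) (-κ) (s + r) / poch br (-δ) (((s : ℂ) + r) * δ) (s + r))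
    = (-1) ^ (p + s) * (poch br δ κ (p + s) / poch br δ δ (s + p)) *
      (poch br δ (δ - κ - (r : ℂ) * δ) r * poch br δ (κ + ((p : ℂ) + s) * δ) r /
        (poch br δ (-(r : ℂ) * δ) r * poch br δ (((p : ℂ) + s + 1) * δ) r)) := by
  have e1 : ∀ n : ℕ, poch br δ (-(n : ℂ) * δ) n = (-1) ^ n * poch br δ δ n := fun n => by
    rw [poch_reflect hodd]
    congr 2
    ring
  have e2 : ∀ n : ℕ, poch br (-δ) ((n : ℂ) * δ) n = poch br δ δ n := fun n => by
    rw [show (n : ℂ) * δ = -(-(n : ℂ) * δ) by ring, poch_neg_neg hodd, e1, ← mul_assoc, ← mul_pow]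
    simp
  have e3 : poch br δ (δ - κ - (r : ℂ) * δ) r = (-1) ^ r * poch br δ κ r := by
    rw [poch_reflect hodd]
    congr 2
    ring
  have e4 : poch br δ (((p : ℂ) + s + 1) * δ) r * poch br δ δ (p + s) = poch br δ δ (p + s + r) := by
    rw [poch_add _ (p + s), mul_comm]
    congr 2
    push_cast
    ring
  have e5 : poch br δ (κ + ((p : ℂ) + s) * δ) r * poch br δ κ (p + s) = poch br δ κ (p + s + r) := by
    rw [poch_add _ (p + s), mul_comm]
    congr 2
    push_cast
    ring
  have n1 : ∀ n, poch br δ δ n ≠ 0 := fun n => poch_ne_zero fun t _ => by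
    convert h (1 + t) 0 (by omega) using 2
    simp [latticePt]
    ring
  have n2 : ∀ n, poch br δ κ n ≠ 0 := fun n => poch_ne_zero fun t _ => by
    convert h t 1 (by omega) using 2
    simp [latticePt]
    ring
  have hs : ∀ n : ℕ, ((-1 : ℂ) ^ n) ≠ 0 := fun n => by simp
  have f1 := e1 (p + r)
  have f2 := e2 (s + r)
  push_cast at f1 f2
  rw [f1, f2, e1, e3, poch_neg_neg hodd, eq_div_iff_mul_eq (n1 _) |>.2 e4,
    eq_div_iff_mul_eq (n2 _) |>.2 e5]
  have hq : ∀ n : ℕ, ((-1 : ℂ) ^ n) ^ 2 = 1 := fun n => by rw [← pow_mul, mul_comm, pow_mul]; simp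
  have := n1 (p + s)
  have := n2 (p + s)
  have := n1 (p + s + r)
  have := hs r
  rw [add_comm s p]
  rcases hi with rfl | rfl
  · simp only [zero_add] at *
    have := n1 r
    have := n1 (s + r)
    rw [pow_add]
    field_simp
  · simp only [zero_add, add_zero] at *
    have := n1 r
    have := n1 (p + r)
    have := hs p
    rw [pow_add]
    field_simp
    rw [hq, mul_one]

lemma opPair_mul_opPair_hat (hodd : ∀ z : ℂ, br (-z) = -br z) {X : α ⊕ β → ℂ}
    {p ρ s : α ⊕ β → ℕ} (hX : IsGeneric br δ κ X) (hv : IsValid p ρ s) (i j : α ⊕ β) :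
    opPair br δ κ X (p + ρ) i j *
      opPair br (-δ) (-κ) (fun i => X i + ((p i : ℂ) + ρ i) * gvec δ κ i - gvec δ κ i) (s + ρ) i j
    = (-1) ^ (p i + s i) * (gaugeA br δ κ X p ρ s j i / gaugeA br δ κ X p ρ s i j) *
      (gaugeB br δ X p ρ i j / gaugeB br δ X p ρ j i) * ratioPair br δ κ X p s i j *
      sourcePair br δ (δ - κ) (fun i => X i + (p i : ℂ) * δ)
        (fun i => X i + dvec δ κ i - (s i : ℂ) * δ) ρ i j := by
  rcases eq_or_ne i j with rfl | hij
  · rw [div_self (gaugeA_ne_zero hX hv i i), div_self (gaugeB_ne_zero hX i i), mul_one, mul_one]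
    rcases i with a | b
    · have := opPair_diag (r := ρ (.inl a)) hodd hX.self (hv.inl a)
      simp only [opPair, ratioPair, sourcePair, dvec, gvec, Sum.elim_inl, Pi.add_apply]
      push_cast
      ring_nf at this ⊢
      exact this
    · have h1 := hX.self 1 0 (by simp)
      have h2 := hX.self 0 1 (by simp)
      simp only [latticePt, Int.cast_one, Int.cast_zero, zero_add, one_mul, zero_mul, add_zero]
        at h1 h2
      have e4 : δ - κ + X (.inr b) - (X (.inr b) + δ) = -κ := by ring
      rcases hv.inr b with h | h | h | h <;> obtain ⟨e1, e2, e3⟩ := h <;>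
        simp [opPair, ratioPair, sourcePair, dvec, gvec, e1, e2, e3, e4, hodd, h1]
      rw [mul_comm, div_self (mul_ne_zero h1 h2)]
  · rcases i with a | b <;> rcases j with a' | b'
    · have := opPair_xx (r := ρ (.inl a)) (R := ρ (.inl a')) hodd (hX.pair _ _ hij)
        (hv.inl a) (hv.inl a')
      simp only [opPair, ratioPair, sourcePair, gaugeA, gaugeB, dvec, gvec, latticePt,
        Sum.elim_inl, Pi.add_apply] at this ⊢
      push_cast at this ⊢
      ring_nf at this ⊢
      exact this
    · have := opPair_xy (r := ρ (.inl a)) (R := ρ (.inr b')) hodd (hX.pair _ _ hij)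
        (hv.inl a) (hv.inr b')
      simp only [opPair, ratioPair, sourcePair, gaugeA, gaugeB, dvec, gvec, latticePt,
        Sum.elim_inl, Sum.elim_inr, Pi.add_apply] at this ⊢
      push_cast at this ⊢
      ring_nf at this ⊢
      exact this
    · have := opPair_yx (r := ρ (.inr b)) (R := ρ (.inl a')) hodd (hX.pair _ _ hij)
        (hv.inr b) (hv.inl a')
      simp only [opPair, ratioPair, sourcePair, gaugeA, gaugeB, dvec, gvec, latticePt,
        Sum.elim_inl, Sum.elim_inr, Pi.add_apply] at this ⊢
      push_cast at this ⊢
      ring_nf at this ⊢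
      exact this
    · have := opPair_yy (r := ρ (.inr b)) (R := ρ (.inr b')) hodd (hX.pair _ _ hij)
        (hv.inr b) (hv.inr b')
      simp only [opPair, ratioPair, sourcePair, gaugeA, gaugeB, dvec, gvec, latticePt,
        Sum.elim_inr, Pi.add_apply] at this ⊢
      push_cast at this ⊢
      ring_nf at this ⊢
      exact this

end OperatorCoefficients

section CompositeCoefficients

variable {br : ℂ → ℂ} {δ κ : ℂ} {α β : Type*}

lemma IsValid.symm {p ρ s : α ⊕ β → ℕ} (h : IsValid p ρ s) : IsValid s ρ p where
  inl a := (h.inl a).symm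
  inr b := by
    have := h.inr b
    unfold IsOdd at *
    tauto

lemma IsGeneric.tilde {X : α ⊕ β → ℂ} (h : IsGeneric br δ κ X) :
    IsGeneric br (-δ) (-κ) (fun i => X i - gvec δ κ i) where
  pair i j hij n l := by
    rcases i with a | b <;> rcases j with a' | b'
    · convert h.pair _ _ hij (-n) (-l) using 2
      simp [latticePt, gvec]
    · convert h.pair _ _ hij (-n - 1) (-l - 1) using 2
      simp [latticePt, gvec]
      ring
    · convert h.pair _ _ hij (-n + 1) (-l + 1) using 2
      simp [latticePt, gvec]
      ring
    · convert h.pair _ _ hij (-n) (-l) using 2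
      simp [latticePt, gvec]
  self n l hnl := by
    convert h.self (-n) (-l) (by omega) using 2
    simp [latticePt]

lemma ratioPair_tilde (hodd : ∀ z : ℂ, br (-z) = -br z) {X : α ⊕ β → ℂ} {p ρ s : α ⊕ β → ℕ}
    (hX : IsGeneric br δ κ X) (hv : IsValid p ρ s) (i j : α ⊕ β) :
    ratioPair br (-δ) (-κ) (fun i => X i - gvec δ κ i) s p i j
      = (-1) ^ (p i + s i) * (-1) ^ (p j + s j) * ratioPair br δ κ X p s j i := by
  have hneg : ∀ (w : ℂ) (k : ℕ), poch br (-δ) w k = (-1) ^ k * poch br δ (-w) k := fun w k => by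
    rw [← poch_neg_neg hodd, neg_neg]
  have hsq : ∀ n : ℕ, (-1 : ℂ) ^ (n * 2) = 1 := fun n => by rw [mul_comm, pow_mul]; simp
  rcases i with a | b <;> rcases j with a' | b'
  · simp only [ratioPair, hneg, gvec, Sum.elim_inl]
    ring_nf
    simp
    ring_nf
  · simp only [ratioPair, hneg, gvec, Sum.elim_inl, Sum.elim_inr]
    ring_nf
    simp
    ring_nf
  · simp only [ratioPair, hneg, gvec, Sum.elim_inl, Sum.elim_inr]
    ring_nf
    simp
    ring_nf
  · have hY : br (X (.inr b') - X (.inr b) + δ) ≠ 0 := by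
      rcases eq_or_ne b b' with rfl | hne
      · simpa [latticePt] using hX.self 1 0 (by simp)
      · simpa [latticePt] using hX.pair (.inr b') (.inr b) (by simpa using hne.symm) 1 0
    simp only [ratioPair, hneg, gvec, Sum.elim_inr]
    rcases hv.inr b with h | h | h | h <;> obtain ⟨e1, -, e3⟩ := h <;>
    rcases hv.inr b' with h | h | h | h <;> obtain ⟨f1, -, f3⟩ := h <;>
    simp [e1, e3, f1, f3] at hY ⊢
    all_goals
      ring_nf at hY ⊢
      try field_simp [hY]

lemma sourceTerm_neg {ι : Type*} [Fintype ι] (hodd : ∀ z : ℂ, br (-z) = -br z) (q : ℂ)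
    (X Z : ι → ℂ) (ρ : ι → ℕ) :
    sourceTerm br (-δ) (-q) (fun i => Z i - q) (fun i => X i - q) ρ
      = sourceTerm br δ q (-Z) (-X) ρ := by
  have hneg : ∀ (w : ℂ) (k : ℕ), poch br (-δ) w k = (-1) ^ k * poch br δ (-w) k := fun w k => by
    rw [← poch_neg_neg hodd, neg_neg]
  have hc : ∀ c a b d e : ℂ, c ≠ 0 → c * a * (c * b) / (c * d * (c * e)) = a * b / (d * e) :=
    fun c a b d e h => by
      rw [mul_mul_mul_comm c a c b, mul_mul_mul_comm c d c e,
        mul_div_mul_left _ _ (mul_ne_zero h h)]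
  unfold sourceTerm sourcePair
  refine prod_congr rfl fun i _ => prod_congr rfl fun j _ => ?_
  simp only [hneg, Pi.neg_apply]
  rw [hc _ _ _ _ _ (by simp)]
  congr 3 <;> ring

section Fintype

variable [Fintype α] [Fintype β]

/-- The product of all the pair factors of an operator coefficient. -/
noncomputable def opTerm (br : ℂ → ℂ) (δ κ : ℂ) (X : α ⊕ β → ℂ) (M : α ⊕ β → ℕ) : ℂ :=
  ∏ i, ∏ j, opPair br δ κ X M i j

/-- The factor relating composite operator coefficients and terms of the source identity. -/
noncomputable def ratioTerm (br : ℂ → ℂ) (δ κ : ℂ) (X : α ⊕ β → ℂ) (p s : α ⊕ β → ℕ) : ℂ :=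
  (∏ i, ∏ _j : α ⊕ β, (-1) ^ (p i + s i)) * ∏ i, ∏ j, ratioPair br δ κ X p s i j

lemma opTerm_mul_opTerm_hat (hodd : ∀ z : ℂ, br (-z) = -br z) {X : α ⊕ β → ℂ}
    {p ρ s : α ⊕ β → ℕ} (hX : IsGeneric br δ κ X) (hv : IsValid p ρ s) :
    opTerm br δ κ X (p + ρ) *
      opTerm br (-δ) (-κ) (fun i => X i + ((p i : ℂ) + ρ i) * gvec δ κ i - gvec δ κ i) (s + ρ)
    = ratioTerm br δ κ X p s *
      sourceTerm br δ (δ - κ) (fun i => X i + (p i : ℂ) * δ)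
        (fun i => X i + dvec δ κ i - (s i : ℂ) * δ) ρ := by
  unfold opTerm ratioTerm sourceTerm
  simp only [← prod_mul_distrib, opPair_mul_opPair_hat hodd hX hv]
  simp only [prod_mul_distrib, prod_div_distrib]
  have hA : ∏ i, ∏ j, gaugeA br δ κ X p ρ s j i = ∏ i, ∏ j, gaugeA br δ κ X p ρ s i j :=
    prod_comm
  have hB : ∏ i, ∏ j, gaugeB br δ X p ρ j i = ∏ i, ∏ j, gaugeB br δ X p ρ i j := prod_comm
  rw [hA, hB, div_self, div_self, mul_one, mul_one]
  · exact prod_ne_zero_iff.2 fun i _ => prod_ne_zero_iff.2 fun j _ => gaugeB_ne_zero hX i j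
  · exact prod_ne_zero_iff.2 fun i _ => prod_ne_zero_iff.2 fun j _ => gaugeA_ne_zero hX hv i j

lemma ratioTerm_tilde (hodd : ∀ z : ℂ, br (-z) = -br z) {X : α ⊕ β → ℂ} {p ρ s : α ⊕ β → ℕ}
    (hX : IsGeneric br δ κ X) (hv : IsValid p ρ s) :
    ratioTerm br (-δ) (-κ) (fun i => X i - gvec δ κ i) s p = ratioTerm br δ κ X p s := by
  unfold ratioTerm
  simp only [ratioPair_tilde hodd hX hv, prod_mul_distrib, add_comm (s _) (p _)]
  have h1 : ∏ i, ∏ j, ratioPair br δ κ X p s j i = ∏ i, ∏ j, ratioPair br δ κ X p s i j :=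
    prod_comm
  have h2 : ∏ _i : α ⊕ β, ∏ j, (-1 : ℂ) ^ (p j + s j) = ∏ j, ∏ _i : α ⊕ β, (-1 : ℂ) ^ (p j + s j) :=
    prod_comm
  have h3 : (∏ i, ∏ _j : α ⊕ β, (-1 : ℂ) ^ (p i + s i)) *
      ∏ i, ∏ _j : α ⊕ β, (-1 : ℂ) ^ (p i + s i) = 1 := by
    simp only [← prod_mul_distrib, ← mul_pow]
    simp
  rw [h1, h2, h3, one_mul]

lemma opTerm_hat_mul_opTerm (hodd : ∀ z : ℂ, br (-z) = -br z) {X : α ⊕ β → ℂ}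
    {p ρ s : α ⊕ β → ℕ} (hX : IsGeneric br δ κ X) (hv : IsValid p ρ s) :
    opTerm br (-δ) (-κ) (fun i => X i - gvec δ κ i) (s + ρ) *
      opTerm br δ κ (fun i => X i - ((s i : ℂ) + ρ i) * gvec δ κ i) (p + ρ)
    = ratioTerm br δ κ X p s *
      sourceTerm br δ (δ - κ) (-fun i => X i + dvec δ κ i - (s i : ℂ) * δ)
        (-fun i => X i + (p i : ℂ) * δ) ρ := by
  have h := opTerm_mul_opTerm_hat hodd hX.tilde hv.symm
  rw [ratioTerm_tilde hodd hX hv] at h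
  rw [← sourceTerm_neg hodd]
  have hd : ∀ i : α ⊕ β, dvec (-δ) (-κ) i = -dvec δ κ i := by rintro (a | b) <;> simp [dvec]
  have hg : ∀ i : α ⊕ β, gvec (-δ) (-κ) i = -gvec δ κ i := by rintro (a | b) <;> simp [gvec]
  have hdg : ∀ i : α ⊕ β, gvec δ κ i = δ - κ - dvec δ κ i := by
    rintro (a | b) <;> simp [dvec, gvec]
  convert h using 2
  · simp only [neg_neg, hg]
    congr 1
    funext i
    ring
  · simp only [hd, hdg]
    congr 1
    · ring
    · funext i
      ring
    · funext i
      ring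

end Fintype

end CompositeCoefficients

section ComponentIdentity

variable {br : ℂ → ℂ} {δ κ : ℂ} {α β : Type*} [Fintype α] [Fintype β] [DecidableEq α]
  [DecidableEq β]

lemma sourceTerm_eq_zero {ι : Type*} [Fintype ι] (hodd : ∀ z : ℂ, br (-z) = -br z) {q : ℂ}
    {X Z : ι → ℂ} {ρ : ι → ℕ} (j : ι) {t : ℕ} (ht : t < ρ j)
    (h : X j - Z j + (t : ℂ) * δ = 0) : sourceTerm br δ q X Z ρ = 0 := by
  refine prod_eq_zero (mem_univ j) (prod_eq_zero (mem_univ j) ?_)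
  have h0 : poch br δ (X j - Z j) (ρ j) = 0 :=
    prod_eq_zero (mem_range.2 ht) (by rw [h, bracket_zero hodd])
  rw [sourcePair, h0, mul_zero, zero_div]

open Classical in
/-- Equality of the coefficients of a fixed shift operator in the two compositions,
at points in general position. -/
theorem sum_opTerm_mul_opTerm_comm (hodd : ∀ z : ℂ, br (-z) = -br z)
    (hent : Differentiable ℂ br) (hnz : br ≠ 0)
    (hW : ∀ a b c d : ℂ,
      br (a + b) * br (a - b) * br (c + d) * br (c - d)
        + br (a + d) * br (a - d) * br (b + c) * br (b - c)
        = br (a + c) * br (a - c) * br (b + d) * br (b - d))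
    {X : α ⊕ β → ℂ} (hX : IsGeneric br δ κ X) (n : ℕ) (p s : α ⊕ β → ℕ)
    (hps : ∀ i, p i = 0 ∨ s i = 0) (hp : ∀ b, p (.inr b) ≤ 1) (hs : ∀ b, s (.inr b) ≤ 1) :
    ∑ ρ ∈ (piAntidiag univ n).filter (fun ρ => IsValid p ρ s),
      opTerm br δ κ X (p + ρ) *
        opTerm br (-δ) (-κ) (fun i => X i + ((p i : ℂ) + ρ i) * gvec δ κ i - gvec δ κ i) (s + ρ)
    = ∑ ρ ∈ (piAntidiag univ n).filter (fun ρ => IsValid p ρ s),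
      opTerm br (-δ) (-κ) (fun i => X i - gvec δ κ i) (s + ρ) *
        opTerm br δ κ (fun i => X i - ((s i : ℂ) + ρ i) * gvec δ κ i) (p + ρ) := by
  rw [sum_congr rfl fun ρ hρ => opTerm_mul_opTerm_hat hodd hX (mem_filter.1 hρ).2,
    sum_congr rfl fun ρ hρ => opTerm_hat_mul_opTerm hodd hX (mem_filter.1 hρ).2,
    ← mul_sum, ← mul_sum]
  have hinv : ∀ ρ : α ⊕ β → ℕ, ¬ IsValid p ρ s →
      ∃ b, ∃ t : ℕ, t < ρ (.inr b) ∧ ((p (.inr b) : ℂ) + s (.inr b) - 1) + t = 0 := by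
    intro ρ hρ
    by_contra hcon
    refine hρ ⟨fun a => hps _, fun b => ?_⟩
    by_contra hodd'
    refine hcon ⟨b, 1 - p (.inr b) - s (.inr b), ?_, ?_⟩
    · have := hps (.inr b)
      have := hp b
      have := hs b
      unfold IsOdd at hodd'
      omega
    · have h1 : p (.inr b) + s (.inr b) ≤ 1 := by
        have := hps (.inr b)
        have := hp b
        have := hs b
        omega
      rw [Nat.sub_sub, Nat.cast_sub h1]
      push_cast
      ring
  rw [sum_filter_of_ne, sum_filter_of_ne, sum_sourceTerm_swap hodd hent hnz hW]
  · intro k hk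
    simpa [latticePt] using hX.self k 0 (Or.inl hk)
  · intro i j hij k
    convert hX.pair i j hij (p i - p j + k) 0 using 2
    simp [latticePt]
    ring
  · intro i j hij k
    rcases i with a | b <;> rcases j with a' | b'
    · convert hX.pair _ _ hij (s (.inl a') - s (.inl a) + k) 0 using 2
      simp [latticePt, dvec]
      ring
    · convert hX.pair _ _ hij (s (.inr b') - s (.inl a) + k - 1) (-1) using 2
      simp [latticePt, dvec]
      ring
    · convert hX.pair _ _ hij (s (.inl a') - s (.inr b) + k + 1) 1 using 2
      simp [latticePt, dvec]
      ring
    · convert hX.pair _ _ hij (s (.inr b') - s (.inr b) + k) 0 using 2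
      simp [latticePt, dvec]
      ring
  · intro i j t _
    rcases eq_or_ne i j with rfl | hij
    · rcases i with a | b
      · convert hX.self (1 + p (.inl a) + s (.inl a) + t) 0 (by omega) using 2
        simp [latticePt, dvec]
        ring
      · convert hX.self (p (.inr b) + s (.inr b) + t) (-1) (by omega) using 2
        simp [latticePt, dvec]
        ring
    · rcases j with a | b
      · convert hX.pair _ _ hij (1 + p i + s (.inl a) + t) 0 using 2
        simp [latticePt, dvec]
        ring
      · convert hX.pair _ _ hij (p i + s (.inr b) + t) (-1) using 2
        simp [latticePt, dvec]
        ring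
  · intro ρ _ hne
    by_contra hρ
    obtain ⟨b, t, ht, h0⟩ := hinv ρ hρ
    refine hne (sourceTerm_eq_zero hodd (.inr b) ht ?_)
    simp only [Pi.neg_apply, dvec, Sum.elim_inr]
    linear_combination δ * h0
  · intro ρ _ hne
    by_contra hρ
    obtain ⟨b, t, ht, h0⟩ := hinv ρ hρ
    refine hne (sourceTerm_eq_zero hodd (.inr b) ht ?_)
    simp only [dvec, Sum.elim_inr]
    linear_combination δ * h0

end ComponentIdentity

section CoefFormula

variable {br : ℂ → ℂ} {δ κ : ℂ}

lemma prod_prod_eq_prod_prod_lt {ι : Type*} [Fintype ι] [LinearOrder ι] (f : ι → ι → ℂ) :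
    ∏ i, ∏ j, f i j
      = ∏ i, ∏ j, if i < j then f i j * f j i else if i = j then f i j else 1 := by
  have h1 : ∀ i j, (if i < j then f i j * f j i else if i = j then f i j else 1)
      = (if i < j then f i j else 1) * (if i < j then f j i else 1) *
        (if i = j then f i j else 1) := fun i j => by
    rcases lt_trichotomy i j with h | h | h
    · simp [h, h.ne]
    · simp [h]
    · simp [h.not_gt, h.ne']
  have h2 : ∏ i, ∏ j, (if i < j then f j i else 1) = ∏ i, ∏ j, (if j < i then f i j else 1) :=
    prod_comm
  simp only [h1, prod_mul_distrib]
  rw [h2]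
  simp only [← prod_mul_distrib]
  refine prod_congr rfl fun i _ => prod_congr rfl fun j _ => ?_
  rcases lt_trichotomy i j with h | h | h
  · simp [h, h.ne, h.not_gt]
  · simp [h]
  · simp [h, h.not_gt, h.ne']

lemma bracket_div_mul_poch (hodd : ∀ z : ℂ, br (-z) = -br z) {u : ℂ}
    (h : ∀ n l : ℤ, br (latticePt u δ κ n l) ≠ 0) (a b : ℕ) :
    br (u + ((a : ℂ) - b) * δ) / br u *
      (poch br δ (u - (b : ℂ) * δ) a * poch br δ (-u - (a : ℂ) * δ) b)
    = poch br δ (u + δ) a * poch br δ (-u + δ) b := by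
  have key : poch br δ (latticePt u δ κ (a - b) 0) 1 / poch br δ (latticePt u δ κ 0 0) 1 *
      (poch br δ (latticePt u δ κ (-b) 0) a * poch br δ (-latticePt u δ κ a 0) b)
      = poch br δ (latticePt u δ κ 1 0) a * poch br δ (-latticePt u δ κ (-1) 0) b := by
    obtain ⟨G, hG, h1, h2, h3⟩ := exists_lattice_gamma hodd h
    simp only [h1, h3]
    push_cast
    ring_nf
    field_simp [hG]
  simp only [latticePt, poch_one] at key
  push_cast at key
  ring_nf at key ⊢
  exact key

lemma sfac_natCast (a x : ℂ) (k : ℕ) : sfac br a x (k : ℤ) = poch br a x k := by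
  simp [sfac, poch]

/-- The exponent vector of a pair `(μ, I)`. -/
def expVec {m r : ℕ} (μ : Fin m → ℕ) (I : Finset (Fin r)) : Fin m ⊕ Fin r → ℕ :=
  Sum.elim μ fun j => if j ∈ I then 1 else 0

/-- The operator coefficients as products over pairs of variables. -/
theorem Coef_eq_opTerm (hodd : ∀ z : ℂ, br (-z) = -br z) {m r : ℕ} (μ : Fin m → ℕ)
    (I : Finset (Fin r)) {x : Fin m → ℂ} {y : Fin r → ℂ}
    (hX : IsGeneric br δ κ (Sum.elim x y)) :
    Coef br δ κ μ I x y
      = (-1) ^ ((∑ i, μ i) + I.card) * opTerm br δ κ (Sum.elim x y) (expVec μ I) := by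
  have hxx : ∀ i j, i ≠ j → ∀ n : ℤ, br (x i - x j + (n : ℂ) * δ) ≠ 0 := fun i j hij n => by
    simpa [latticePt] using hX.pair (.inl i) (.inl j) (by simpa using hij) n 0
  have hxy : ∀ i j, ∀ n : ℤ, br (x i - y j + (n : ℂ) * δ) ≠ 0 := fun i j n => by
    simpa [latticePt] using hX.pair (.inl i) (.inr j) (by simp) n 0
  have hself : ∀ n : ℤ, n ≠ 0 → br ((n : ℂ) * δ) ≠ 0 := fun n hn => by
    simpa [latticePt] using hX.self n 0 (Or.inl hn)
  have hyy : ∀ i j, i ≠ j → ∀ n : ℤ, br (y i - y j + (n : ℂ) * δ) ≠ 0 := fun i j hij n => by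
    simpa [latticePt] using hX.pair (.inr i) (.inr j) (by simpa using hij) n 0
  have exx : (∏ i : Fin m, ∏ j : Fin m,
        if i < j then br (x i - x j + ((μ i : ℂ) - (μ j : ℂ)) * δ) / br (x i - x j) else 1)
      * (∏ i : Fin m, ∏ j : Fin m,
        sfac br δ (x i - x j + κ) (μ i : ℤ) / sfac br δ (x i - x j + δ) (μ i : ℤ))
      = (-1) ^ (∑ i, μ i) * ∏ i, ∏ j, opPair br δ κ (Sum.elim x y) (expVec μ I) (.inl i) (.inl j) := by
    have hE : (∏ i, ∏ j, poch br δ (x i - x j - (μ j : ℂ) * δ) (μ i)) ≠ 0 := by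
      refine prod_ne_zero_iff.2 fun i _ => prod_ne_zero_iff.2 fun j _ => poch_ne_zero fun t ht => ?_
      rcases eq_or_ne i j with rfl | hij
      · convert hself (t - μ i) (by omega) using 2
        push_cast
        ring
      · convert hxx i j hij (t - μ j) using 2
        push_cast
        ring
    have hD : (∏ i, ∏ j, poch br δ (x i - x j + δ) (μ i)) ≠ 0 := by
      refine prod_ne_zero_iff.2 fun i _ => prod_ne_zero_iff.2 fun j _ => poch_ne_zero fun t ht => ?_
      rcases eq_or_ne i j with rfl | hij
      · convert hself (t + 1) (by omega) using 2
        push_cast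
        ring
      · convert hxx i j hij (t + 1) using 2
        push_cast
        ring
    have key : (∏ i : Fin m, ∏ j : Fin m,
        if i < j then br (x i - x j + ((μ i : ℂ) - (μ j : ℂ)) * δ) / br (x i - x j) else 1) *
        (∏ i, ∏ j, poch br δ (x i - x j - (μ j : ℂ) * δ) (μ i))
        = (-1) ^ (∑ i, μ i) * ∏ i, ∏ j, poch br δ (x i - x j + δ) (μ i) := by
      have hs : ((-1 : ℂ)) ^ (∑ i, μ i) = ∏ i, ∏ j, if i = j then (-1) ^ μ i else 1 := by
        simp [prod_pow_eq_pow_sum]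
      rw [hs, prod_prod_eq_prod_prod_lt
        (fun i j => poch br δ (x i - x j - (μ j : ℂ) * δ) (μ i))]
      simp only [← prod_mul_distrib]
      rw [prod_prod_eq_prod_prod_lt
          (fun i j => (if i = j then (-1) ^ μ i else 1) * poch br δ (x i - x j + δ) (μ i))]
      refine prod_congr rfl fun i _ => prod_congr rfl fun j _ => ?_
      rcases lt_trichotomy i j with h | h | h
      · simp only [h, if_true, h.ne, h.ne', if_false, one_mul]
        have := bracket_div_mul_poch hodd
          (hX.pair (.inl i) (.inl j) (by simpa using h.ne)) (μ i) (μ j)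
        simpa only [Sum.elim_inl, neg_sub] using this
      · subst h
        simp only [lt_irrefl, if_false, if_true, sub_self, zero_sub, zero_add, one_mul]
        rw [poch_reflect hodd]
        congr 2
        ring
      · simp [h.not_gt, h.ne']
    simp only [sfac_natCast, opPair, expVec, dvec, Sum.elim_inl, prod_div_distrib, sub_neg_eq_add]
    rw [← mul_div_assoc, ← mul_div_assoc, div_eq_div_iff hD hE]
    linear_combination (∏ i, ∏ j, poch br δ (x i - x j + κ) (μ i)) * key
  have exy : ∏ i, ∏ j, opPair br δ κ (Sum.elim x y) (expVec μ I) (.inl i) (.inr j)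
      = ∏ i : Fin m, ∏ j ∈ Iᶜ, br (x i - y j - δ) / br (x i - y j + ((μ i : ℂ) - 1) * δ) := by
    refine prod_congr rfl fun i _ => ?_
    rw [← prod_mul_prod_compl I, prod_eq_one, one_mul]
    · refine prod_congr rfl fun j hj => ?_
      simp only [opPair, expVec, dvec, Sum.elim_inl, Sum.elim_inr, mem_compl.1 hj, if_false]
      have h1 : poch br δ (x i - y j) (μ i) ≠ 0 := poch_ne_zero fun t _ => hxy i j t
      have h2 := hxy i j (μ i - 1)
      push_cast at h2
      rw [Nat.cast_zero, zero_mul, sub_zero, div_eq_div_iff h1 h2]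
      have e1 := poch_add (br := br) (δ := δ) (x i - y j - δ) 1 (μ i)
      have e2 := poch_succ (br := br) (δ := δ) (x i - y j - δ) (μ i)
      rw [add_comm, e2, poch_one] at e1
      convert e1 using 3 <;> push_cast <;> ring
    · intro j hj
      simp only [opPair, expVec, dvec, Sum.elim_inl, Sum.elim_inr, hj, if_true, Nat.cast_one,
        one_mul]
      refine div_self (poch_ne_zero fun t _ => ?_)
      convert hxy i j (t - 1) using 2
      push_cast
      ring
  have eyx : ∏ i, ∏ j, opPair br δ κ (Sum.elim x y) (expVec μ I) (.inr i) (.inl j)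
      = ∏ i : Fin m, ∏ j ∈ I, br (x i - y j - κ) / br (x i - y j + (μ i : ℂ) * δ) := by
    rw [prod_comm]
    refine prod_congr rfl fun i _ => ?_
    rw [← prod_mul_prod_compl I, mul_comm, prod_eq_one, one_mul]
    · refine prod_congr rfl fun j hj => ?_
      simp only [opPair, expVec, dvec, Sum.elim_inl, Sum.elim_inr, hj, if_true, poch_one]
      rw [← neg_div_neg_eq, ← hodd, ← hodd]
      congr 2 <;> ring
    · intro j hj
      simp [opPair, expVec, mem_compl.1 hj]
  have eyy : ∏ i, ∏ j, opPair br δ κ (Sum.elim x y) (expVec μ I) (.inr i) (.inr j)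
      = ∏ i ∈ I, ∏ j ∈ Iᶜ, br (y i - y j - δ) / br (y i - y j) := by
    rw [← prod_mul_prod_compl I, mul_comm, prod_eq_one, one_mul]
    · refine prod_congr rfl fun i hi => ?_
      rw [← prod_mul_prod_compl I, prod_eq_one, one_mul]
      · refine prod_congr rfl fun j hj => ?_
        simp [opPair, expVec, dvec, mem_compl.1 hj, hi]
      · intro j hj
        simp only [opPair, expVec, dvec, Sum.elim_inr, hi, hj, if_true, poch_one, Nat.cast_one,
          one_mul]
        refine div_self ?_
        rcases eq_or_ne i j with rfl | hij
        · convert hself (-1) (by simp) using 2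
          push_cast
          ring
        · convert hyy i j hij (-1) using 2
          push_cast
          ring
    · intro i hi
      simp [opPair, expVec, mem_compl.1 hi]
  unfold Coef opTerm
  simp only [Fintype.prod_sum_type, prod_mul_distrib]
  rw [exy, eyx, eyy]
  rw [pow_add]
  linear_combination (-1) ^ I.card *
    (∏ i ∈ I, ∏ j ∈ Iᶜ, br (y i - y j - δ) / br (y i - y j)) *
    (∏ i : Fin m, ∏ j ∈ I, br (x i - y j - κ) / br (x i - y j + (μ i : ℂ) * δ)) *
    (∏ i : Fin m, ∏ j ∈ Iᶜ, br (x i - y j - δ) / br (x i - y j + ((μ i : ℂ) - 1) * δ)) * exx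

end CoefFormula

section Fibers

variable {br : ℂ → ℂ} {δ κ : ℂ} {m r : ℕ}

lemma expVec_inr_le_one (μ : Fin m → ℕ) (I : Finset (Fin r)) (b : Fin r) :
    expVec μ I (.inr b) ≤ 1 := by
  simp only [expVec, Sum.elim_inr]
  split_ifs <;> simp

lemma sum_expVec (μ : Fin m → ℕ) (I : Finset (Fin r)) :
    ∑ i, expVec μ I i = (∑ i, μ i) + I.card := by
  simp [expVec, Fintype.sum_sum_type]

lemma mem_idxSet {k : ℕ} {p : (Fin m → ℕ) × Finset (Fin r)} :
    p ∈ idxSet m r k ↔ ∑ i, expVec p.1 p.2 i = k := by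
  rw [sum_expVec]
  simp only [idxSet, mem_filter, mem_product, Fintype.mem_piFinset, mem_range, mem_univ, and_true,
    and_iff_right_iff_imp]
  intro h i
  have := single_le_sum (f := p.1) (fun _ _ => Nat.zero_le _) (mem_univ i)
  omega

lemma expVec_injective {p q : (Fin m → ℕ) × Finset (Fin r)}
    (h : expVec p.1 p.2 = expVec q.1 q.2) : p = q := by
  refine Prod.ext (funext fun i => congrFun h (.inl i)) (Finset.ext fun j => ?_)
  have := congrFun h (.inr j)
  simp only [expVec, Sum.elim_inr] at this
  split_ifs at this <;> simp_all

lemma exists_expVec_eq {M : Fin m ⊕ Fin r → ℕ} (h : ∀ b, M (.inr b) ≤ 1) :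
    ∃ p : (Fin m → ℕ) × Finset (Fin r), expVec p.1 p.2 = M := by
  refine ⟨(fun i => M (.inl i), univ.filter fun j => M (.inr j) = 1), funext fun i => ?_⟩
  rcases i with a | b
  · simp [expVec]
  · have := h b
    simp only [expVec, Sum.elim_inr, mem_filter, mem_univ, true_and]
    split_ifs <;> omega

lemma IsGeneric.shift {α β : Type*} {X : α ⊕ β → ℂ} (h : IsGeneric br δ κ X) (c : α ⊕ β → ℤ) :
    IsGeneric br δ κ (fun i => X i + (c i : ℂ) * gvec δ κ i) where
  pair i j hij n l := by
    rcases i with a | b <;> rcases j with a' | b'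
    · convert h.pair _ _ hij (n + c (.inl a) - c (.inl a')) l using 2
      simp [latticePt, gvec]
      ring
    · convert h.pair _ _ hij (n + c (.inl a)) (l + c (.inr b')) using 2
      simp [latticePt, gvec]
      ring
    · convert h.pair _ _ hij (n - c (.inl a')) (l - c (.inr b)) using 2
      simp [latticePt, gvec]
      ring
    · convert h.pair _ _ hij n (l - c (.inr b) + c (.inr b')) using 2
      simp [latticePt, gvec]
      ring
  self := h.self

/-- Coefficient of the term `(p, q)` in `H Ĥ`. -/
noncomputable def coefHHhat (br : ℂ → ℂ) (δ κ : ℂ) (p q : (Fin m → ℕ) × Finset (Fin r))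
    (x : Fin m → ℂ) (y : Fin r → ℂ) : ℂ :=
  Coef br δ κ p.1 p.2 x y *
    Coef br (-δ) (-κ) q.1 q.2 (fun i => xshift δ p.1 x i - δ) (fun j => yshift κ p.2 y j + κ)

/-- Coefficient of the term `(q, p)` in `Ĥ H`. -/
noncomputable def coefHhatH (br : ℂ → ℂ) (δ κ : ℂ) (p q : (Fin m → ℕ) × Finset (Fin r))
    (x : Fin m → ℂ) (y : Fin r → ℂ) : ℂ :=
  Coef br (-δ) (-κ) q.1 q.2 (fun i => x i - δ) (fun j => y j + κ) *
    Coef br δ κ p.1 p.2 (xshift (-δ) q.1 x) (yshift (-κ) q.2 y)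

lemma elim_sub_gvec (x : Fin m → ℂ) (y : Fin r → ℂ) :
    (Sum.elim (fun i => x i - δ) fun j => y j + κ)
      = fun i => Sum.elim x y i - gvec δ κ i := by
  funext i
  rcases i with a | b <;> simp [gvec]

lemma elim_xshift_yshift (p : (Fin m → ℕ) × Finset (Fin r)) (x : Fin m → ℂ) (y : Fin r → ℂ) :
    Sum.elim (xshift δ p.1 x) (yshift κ p.2 y)
      = fun i => Sum.elim x y i + (expVec p.1 p.2 i : ℂ) * gvec δ κ i := by
  funext i
  rcases i with a | b
  · simp [gvec, xshift, expVec, mul_comm]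
  · simp [gvec, yshift, expVec, sub_eq_add_neg]

lemma elim_xshift_yshift_neg (p : (Fin m → ℕ) × Finset (Fin r)) (x : Fin m → ℂ)
    (y : Fin r → ℂ) :
    Sum.elim (xshift (-δ) p.1 x) (yshift (-κ) p.2 y)
      = fun i => Sum.elim x y i - (expVec p.1 p.2 i : ℂ) * gvec δ κ i := by
  funext i
  rcases i with a | b
  · simp [gvec, xshift, expVec, mul_comm, sub_eq_add_neg]
  · simp [gvec, yshift, expVec]
    split_ifs <;> simp

lemma coefHHhat_eq (hodd : ∀ z : ℂ, br (-z) = -br z) {x : Fin m → ℂ} {y : Fin r → ℂ}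
    (hX : IsGeneric br δ κ (Sum.elim x y)) {k l : ℕ} {p q : (Fin m → ℕ) × Finset (Fin r)}
    (hp : p ∈ idxSet m r k) (hq : q ∈ idxSet m r l) :
    coefHHhat br δ κ p q x y
      = (-1) ^ (k + l) * (opTerm br δ κ (Sum.elim x y) (expVec p.1 p.2) *
        opTerm br (-δ) (-κ) (fun i => Sum.elim x y i + (expVec p.1 p.2 i : ℂ) * gvec δ κ i
          - gvec δ κ i) (expVec q.1 q.2)) := by
  have hX' := (hX.shift fun i => (expVec p.1 p.2 i : ℤ)).tilde
  simp only [Int.cast_natCast] at hX'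
  have e : (Sum.elim (fun i => xshift δ p.1 x i - δ) fun j => yshift κ p.2 y j + κ)
      = fun i => Sum.elim x y i + (expVec p.1 p.2 i : ℂ) * gvec δ κ i - gvec δ κ i := by
    rw [elim_sub_gvec, elim_xshift_yshift]
  rw [← e] at hX' ⊢
  rw [coefHHhat, Coef_eq_opTerm hodd _ _ hX, Coef_eq_opTerm hodd _ _ hX', ← sum_expVec,
    ← sum_expVec, mem_idxSet.1 hp, mem_idxSet.1 hq, pow_add]
  ring

lemma coefHhatH_eq (hodd : ∀ z : ℂ, br (-z) = -br z) {x : Fin m → ℂ} {y : Fin r → ℂ}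
    (hX : IsGeneric br δ κ (Sum.elim x y)) {k l : ℕ} {p q : (Fin m → ℕ) × Finset (Fin r)}
    (hp : p ∈ idxSet m r k) (hq : q ∈ idxSet m r l) :
    coefHhatH br δ κ p q x y
      = (-1) ^ (k + l) * (opTerm br (-δ) (-κ) (fun i => Sum.elim x y i - gvec δ κ i)
          (expVec q.1 q.2) *
        opTerm br δ κ (fun i => Sum.elim x y i - (expVec q.1 q.2 i : ℂ) * gvec δ κ i)
          (expVec p.1 p.2)) := by
  have hX' := hX.shift fun i => -(expVec q.1 q.2 i : ℤ)
  simp only [Int.cast_neg, Int.cast_natCast, neg_mul, ← sub_eq_add_neg] at hX'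
  have hX2 := hX.tilde
  rw [← elim_xshift_yshift_neg] at hX' ⊢
  rw [← elim_sub_gvec] at hX2 ⊢
  rw [coefHhatH, Coef_eq_opTerm hodd _ _ hX2, Coef_eq_opTerm hodd _ _ hX', ← sum_expVec,
    ← sum_expVec, mem_idxSet.1 hp, mem_idxSet.1 hq, pow_add]
  ring

/-- The total shift of a pair of indices, one for each operator. -/
def netShift (P : ((Fin m → ℕ) × Finset (Fin r)) × ((Fin m → ℕ) × Finset (Fin r))) :
    Fin m ⊕ Fin r → ℤ :=
  fun i => (expVec P.1.1 P.1.2 i : ℤ) - expVec P.2.1 P.2.2 i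

open Classical in
/-- Reindexing of the pairs with given total shift by their componentwise minimum. -/
lemma sum_fiber_eq {k l : ℕ} {P₀ : ((Fin m → ℕ) × Finset (Fin r)) × ((Fin m → ℕ) × Finset (Fin r))}
    (hP₀ : P₀ ∈ idxSet m r k ×ˢ idxSet m r l) {p s : Fin m ⊕ Fin r → ℕ}
    (hp : ∀ i, p i = (netShift P₀ i).toNat) (hs : ∀ i, s i = (-netShift P₀ i).toNat) {n : ℕ}
    (hn : n + ∑ i, p i = k) (g : (Fin m ⊕ Fin r → ℕ) → (Fin m ⊕ Fin r → ℕ) → ℂ) :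
    ∑ P ∈ (idxSet m r k ×ˢ idxSet m r l).filter (fun P => netShift P = netShift P₀),
        g (expVec P.1.1 P.1.2) (expVec P.2.1 P.2.2)
      = ∑ ρ ∈ (piAntidiag univ n).filter (fun ρ => IsValid p ρ s), g (p + ρ) (s + ρ) := by
  have hdec : ∀ P : ((Fin m → ℕ) × Finset (Fin r)) × ((Fin m → ℕ) × Finset (Fin r)),
      netShift P = netShift P₀ → ∀ i,
      expVec P.1.1 P.1.2 i = p i + min (expVec P.1.1 P.1.2 i) (expVec P.2.1 P.2.2 i) ∧
      expVec P.2.1 P.2.2 i = s i + min (expVec P.1.1 P.1.2 i) (expVec P.2.1 P.2.2 i) := by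
    intro P h i
    have h1 := congrFun h i
    have h2 := hp i
    have h3 := hs i
    simp only [← h1] at h2 h3
    simp only [netShift] at h2 h3
    omega
  have hps : ∀ i, p i = 0 ∨ s i = 0 := fun i => by
    rw [hp, hs]
    omega
  have hdiff : ∀ i, (p i : ℤ) - s i = netShift P₀ i := fun i => by
    rw [hp, hs]
    omega
  have hl : n + ∑ i, s i = l := by
    have h1 := mem_idxSet.1 (mem_product.1 hP₀).1
    have h2 := mem_idxSet.1 (mem_product.1 hP₀).2
    have h3 : ∑ i, netShift P₀ i = (k : ℤ) - l := by
      simp only [netShift, sum_sub_distrib]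
      rw [← h1, ← h2]
      push_cast
      rfl
    simp only [← hdiff, sum_sub_distrib] at h3
    zify at hn ⊢
    linarith
  refine sum_nbij (fun P i => min (expVec P.1.1 P.1.2 i) (expVec P.2.1 P.2.2 i)) ?_ ?_ ?_ ?_
  · intro P hP
    obtain ⟨hP, hPn⟩ := mem_filter.1 hP
    have hd := hdec P hPn
    have h1 := mem_idxSet.1 (mem_product.1 hP).1
    simp only [mem_filter, mem_piAntidiag, mem_univ, implies_true, and_true]
    refine ⟨?_, fun a => hps _, fun b => ?_⟩
    · rw [sum_congr rfl fun i _ => (hd i).1, sum_add_distrib] at h1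
      omega
    · have h2 := hd (.inr b)
      have h3 := expVec_inr_le_one P.1.1 P.1.2 b
      have h4 := expVec_inr_le_one P.2.1 P.2.2 b
      have h5 := hps (.inr b)
      unfold IsOdd
      omega
  · intro P hP Q hQ hPQ
    have hd := hdec P (mem_filter.1 hP).2
    have hd' := hdec Q (mem_filter.1 hQ).2
    have hpq : ∀ i, min (expVec P.1.1 P.1.2 i) (expVec P.2.1 P.2.2 i)
        = min (expVec Q.1.1 Q.1.2 i) (expVec Q.2.1 Q.2.2 i) := congrFun hPQ
    refine Prod.ext (expVec_injective (funext fun i => ?_)) (expVec_injective (funext fun i => ?_))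
    · rw [(hd i).1, (hd' i).1, hpq]
    · rw [(hd i).2, (hd' i).2, hpq]
  · intro ρ hρ
    simp only [coe_filter, mem_piAntidiag, mem_univ, implies_true, and_true,
      Set.mem_ofPred_eq] at hρ
    obtain ⟨hsum, hv⟩ := hρ
    replace hsum : ∑ i, ρ i = n := hsum
    obtain ⟨P1, hP1⟩ := exists_expVec_eq (M := p + ρ) fun b => by
      have := hv.inr b
      unfold IsOdd at this
      simp only [Pi.add_apply]
      omega
    obtain ⟨P2, hP2⟩ := exists_expVec_eq (M := s + ρ) fun b => by
      have := hv.inr b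
      unfold IsOdd at this
      simp only [Pi.add_apply]
      omega
    refine ⟨(P1, P2), ?_, funext fun i => ?_⟩
    · simp only [coe_filter, mem_product, mem_idxSet, Set.mem_ofPred_eq, hP1, hP2, Pi.add_apply,
        sum_add_distrib]
      refine ⟨⟨by omega, by omega⟩, funext fun i => ?_⟩
      simp only [netShift, hP1, hP2, Pi.add_apply]
      rw [← netShift, ← hdiff]
      push_cast
      ring
    · have := hps i
      simp only [hP1, hP2, Pi.add_apply]
      omega
  · intro P hP
    have hd := hdec P (mem_filter.1 hP).2
    congr 1 <;> funext i
    · exact (hd i).1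
    · exact (hd i).2

/-- Equality of the coefficients of a fixed total shift, at points in general position. -/
theorem sum_coef_comm_of_generic (hodd : ∀ z : ℂ, br (-z) = -br z)
    (hent : Differentiable ℂ br) (hnz : br ≠ 0)
    (hW : ∀ a b c d : ℂ,
      br (a + b) * br (a - b) * br (c + d) * br (c - d)
        + br (a + d) * br (a - d) * br (b + c) * br (b - c)
        = br (a + c) * br (a - c) * br (b + d) * br (b - d))
    {x : Fin m → ℂ} {y : Fin r → ℂ} (hX : IsGeneric br δ κ (Sum.elim x y)) (k l : ℕ)
    (c : Fin m ⊕ Fin r → ℤ) :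
    ∑ P ∈ (idxSet m r k ×ˢ idxSet m r l).filter (fun P => netShift P = c),
        coefHHhat br δ κ P.1 P.2 x y
      = ∑ P ∈ (idxSet m r k ×ˢ idxSet m r l).filter (fun P => netShift P = c),
        coefHhatH br δ κ P.1 P.2 x y := by
  classical
  rcases ((idxSet m r k ×ˢ idxSet m r l).filter (fun P => netShift P = c)).eq_empty_or_nonempty
    with h | ⟨P₀, hP₀⟩
  · rw [h, sum_empty, sum_empty]
  obtain ⟨hmem, rfl⟩ := mem_filter.1 hP₀
  obtain ⟨p, hp⟩ : ∃ p : Fin m ⊕ Fin r → ℕ, ∀ i, p i = (netShift P₀ i).toNat := ⟨_, fun _ => rfl⟩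
  obtain ⟨s, hs⟩ : ∃ s : Fin m ⊕ Fin r → ℕ, ∀ i, s i = (-netShift P₀ i).toNat :=
    ⟨_, fun _ => rfl⟩
  obtain ⟨n, hn⟩ : ∃ n, n + ∑ i, p i = k := by
    rw [← mem_idxSet.1 (mem_product.1 hmem).1]
    refine ⟨_, Nat.sub_add_cancel (sum_le_sum fun i _ => ?_)⟩
    rw [hp, netShift]
    omega
  rw [sum_congr rfl fun P hP => coefHHhat_eq hodd hX
      (mem_product.1 (mem_filter.1 hP).1).1 (mem_product.1 (mem_filter.1 hP).1).2,
    sum_congr rfl fun P hP => coefHhatH_eq hodd hX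
      (mem_product.1 (mem_filter.1 hP).1).1 (mem_product.1 (mem_filter.1 hP).1).2,
    ← mul_sum, ← mul_sum]
  congr 1
  have hL := sum_fiber_eq hmem hp hs hn fun M N => opTerm br δ κ (Sum.elim x y) M *
    opTerm br (-δ) (-κ) (fun i => Sum.elim x y i + (M i : ℂ) * gvec δ κ i - gvec δ κ i) N
  have hR := sum_fiber_eq hmem hp hs hn fun M N =>
    opTerm br (-δ) (-κ) (fun i => Sum.elim x y i - gvec δ κ i) N *
      opTerm br δ κ (fun i => Sum.elim x y i - (N i : ℂ) * gvec δ κ i) M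
  have key := sum_opTerm_mul_opTerm_comm hodd hent hnz hW hX n p s
    (fun i => by rw [hp, hs]; omega)
    (fun b => by
      have := expVec_inr_le_one P₀.1.1 P₀.1.2 b
      rw [hp, netShift]
      omega)
    (fun b => by
      have := expVec_inr_le_one P₀.2.1 P₀.2.2 b
      rw [hs, netShift]
      omega)
  simp only [Pi.add_apply, Nat.cast_add] at hL hR
  exact (hL.trans key).trans hR.symm

end Fibers

section Continuity

variable {br : ℂ → ℂ} {δ : ℂ} {m r : ℕ}

lemma continuousAt_Coef {E : Type*} [TopologicalSpace E] (hbr : Continuous br) (a : ℂ)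
    (μ : Fin m → ℕ) (I : Finset (Fin r)) {b : E → ℂ} {x : E → Fin m → ℂ} {y : E → Fin r → ℂ}
    (hb : Continuous b) (hx : Continuous x) (hy : Continuous y) {z : E}
    (h : CDenomNZ br a μ I (x z) (y z)) :
    ContinuousAt (fun w => Coef br a (b w) μ I (x w) (y w)) z := by
  obtain ⟨h1, h2, h3, h4, h5⟩ := h
  have hxi : ∀ i, Continuous fun w => x w i := fun i => (continuous_apply i).comp hx
  have hyi : ∀ i, Continuous fun w => y w i := fun i => (continuous_apply i).comp hy
  have hprod : ∀ {ι : Type} (s : Finset ι) (f : ι → E → ℂ), (∀ i ∈ s, ContinuousAt (f i) z) →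
      ContinuousAt (fun w => ∏ i ∈ s, f i w) z := fun s f hf => tendsto_finsetProd s hf
  have hs : ∀ (f : E → ℂ) (k : ℕ), Continuous f →
      ContinuousAt (fun w => sfac br a (f w) (k : ℤ)) z := fun f k hf => by
    simp only [sfac_natCast, poch]
    exact (continuous_finsetProd _ fun i _ => hbr.comp (by fun_prop)).continuousAt
  unfold Coef
  refine (((ContinuousAt.mul ?_ ?_).mul ?_).mul ?_).mul ?_
  · exact continuousAt_const
  · refine hprod _ _ fun i _ => hprod _ _ fun j _ => ?_
    by_cases hij : i < j
    · simp only [hij, if_true]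
      exact (hbr.comp (by fun_prop)).continuousAt.div (hbr.comp (by fun_prop)).continuousAt
        (h1 i j hij)
    · simp only [hij, if_false]
      exact continuousAt_const
  · exact hprod _ _ fun i hi => hprod _ _ fun j hj => (hbr.comp (by fun_prop)).continuousAt.div
      (hbr.comp (by fun_prop)).continuousAt (h2 i hi j hj)
  · exact hprod _ _ fun i _ => hprod _ _ fun j _ => (hs _ _ (by fun_prop)).div
      (hs _ _ (by fun_prop)) (h3 i j)
  · refine hprod _ _ fun i _ => (hprod _ _ fun j hj => ?_).mul (hprod _ _ fun j hj => ?_)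
    · exact (hbr.comp (by fun_prop)).continuousAt.div (hbr.comp (by fun_prop)).continuousAt
        (h4 i j hj)
    · exact (hbr.comp (by fun_prop)).continuousAt.div (hbr.comp (by fun_prop)).continuousAt
        (h5 i j hj)

/-- Points are generically in general position. -/
lemma eventually_residual_isGeneric (hent : Differentiable ℂ br) (hnz : br ≠ 0)
    (hδ : ∀ n : ℤ, n ≠ 0 → br ((n : ℂ) * δ) ≠ 0) :
    ∀ᶠ z : (Fin m → ℂ) × (Fin r → ℂ) × ℂ in residual _,
      IsGeneric br δ z.2.2 (Sum.elim z.1 z.2.1) := by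
  have hpair : ∀ i j : Fin m ⊕ Fin r, ∀ n l : ℤ,
      ∀ᶠ z : (Fin m → ℂ) × (Fin r → ℂ) × ℂ in residual _, i ≠ j →
      br (latticePt (Sum.elim z.1 z.2.1 i - Sum.elim z.1 z.2.1 j) δ z.2.2 n l) ≠ 0 := by
    intro i j n l
    by_cases hij : i = j
    · exact Filter.Eventually.of_forall fun z h => (h hij).elim
    have hc : Continuous fun z : (Fin m → ℂ) × (Fin r → ℂ) × ℂ =>
        latticePt (Sum.elim z.1 z.2.1 i - Sum.elim z.1 z.2.1 j) δ z.2.2 n l := by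
      unfold latticePt
      rcases i with a | b <;> rcases j with a' | b' <;> simp only [Sum.elim_inl, Sum.elim_inr] <;>
        fun_prop
    refine (eventually_residual_bracket_ne_zero hent hnz hc (a := 1)
      (i.elim (fun a => (Pi.single a 1, 0, 0)) (fun b => (0, Pi.single b 1, 0))) one_ne_zero
      ?_).mono fun z hz _ => hz
    intro z t
    rcases i with a | b <;> rcases j with a' | b' <;> simp [latticePt, Pi.single_apply] <;>
      grind
  have hself : ∀ n l : ℤ, ∀ᶠ z : (Fin m → ℂ) × (Fin r → ℂ) × ℂ in residual _,
      n ≠ 0 ∨ l ≠ 0 → br (latticePt 0 δ z.2.2 n l) ≠ 0 := by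
    intro n l
    by_cases hl : l = 0
    · refine Filter.Eventually.of_forall fun z h => ?_
      simpa [latticePt, hl] using hδ n (by tauto)
    have hc : Continuous fun z : (Fin m → ℂ) × (Fin r → ℂ) × ℂ => latticePt 0 δ z.2.2 n l := by
      unfold latticePt
      fun_prop
    refine (eventually_residual_bracket_ne_zero hent hnz hc (a := l) (0, 0, 1)
      (by simpa using hl) ?_).mono fun z hz _ => hz
    intro z t
    simp [latticePt]
    ring
  simp only [← eventually_countable_forall] at hpair hself
  filter_upwards [hpair, hself] with z h1 h2
  exact ⟨fun i j hij n l => h1 i j n l hij, h2⟩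

end Continuity

section AdmissiblePoints

variable {br : ℂ → ℂ} {δ κ : ℂ} {m r : ℕ}

/-- Equality of the coefficients of a fixed total shift, at admissible points. -/
theorem sum_coef_comm_of_admissible (hodd : ∀ z : ℂ, br (-z) = -br z)
    (hent : Differentiable ℂ br) (hnz : br ≠ 0)
    (hW : ∀ a b c d : ℂ,
      br (a + b) * br (a - b) * br (c + d) * br (c - d)
        + br (a + d) * br (a - d) * br (b + c) * br (b - c)
        = br (a + c) * br (a - c) * br (b + d) * br (b - d))
    (hδ : ∀ n : ℕ, 1 ≤ n → br ((n : ℂ) * δ) ≠ 0) {x : Fin m → ℂ} {y : Fin r → ℂ} {k l : ℕ}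
    (h1 : ∀ p ∈ idxSet m r k, CDenomNZ br δ p.1 p.2 x y)
    (h2 : ∀ p ∈ idxSet m r l,
      CDenomNZ br (-δ) p.1 p.2 (fun i => x i - δ) (fun j => y j + κ))
    (h3 : ∀ p ∈ idxSet m r k, ∀ q ∈ idxSet m r l,
      CDenomNZ br (-δ) q.1 q.2 (fun i => xshift δ p.1 x i - δ)
        (fun j => yshift κ p.2 y j + κ))
    (h4 : ∀ p ∈ idxSet m r l, ∀ q ∈ idxSet m r k,
      CDenomNZ br δ q.1 q.2 (xshift (-δ) p.1 x) (yshift (-κ) p.2 y))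
    (c : Fin m ⊕ Fin r → ℤ) :
    ∑ P ∈ (idxSet m r k ×ˢ idxSet m r l).filter (fun P => netShift P = c),
        coefHHhat br δ κ P.1 P.2 x y
      = ∑ P ∈ (idxSet m r k ×ˢ idxSet m r l).filter (fun P => netShift P = c),
        coefHhatH br δ κ P.1 P.2 x y := by
  have hδ' : ∀ n : ℤ, n ≠ 0 → br ((n : ℂ) * δ) ≠ 0 := by
    intro n hn
    obtain ⟨N, rfl | rfl⟩ := n.eq_nat_or_neg
    · exact_mod_cast hδ N (by omega)
    · simpa [hodd] using hδ N (by omega)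
  refine eq_of_residual (E := (Fin m → ℂ) × (Fin r → ℂ) × ℂ) (p := (x, y, κ))
    (f := fun z => ∑ P ∈ (idxSet m r k ×ˢ idxSet m r l).filter (fun P => netShift P = c),
      coefHHhat br δ z.2.2 P.1 P.2 z.1 z.2.1)
    (g := fun z => ∑ P ∈ (idxSet m r k ×ˢ idxSet m r l).filter (fun P => netShift P = c),
      coefHhatH br δ z.2.2 P.1 P.2 z.1 z.2.1)
    (eventually_residual_isGeneric hent hnz hδ') ?_ ?_
    (Filter.Eventually.of_forall fun z hz =>
      sum_coef_comm_of_generic hodd hent hnz hW hz k l c)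
  · refine tendsto_finsetSum _ fun P hP => ?_
    obtain ⟨hp, hq⟩ := mem_product.1 (mem_filter.1 hP).1
    exact (continuousAt_Coef hent.continuous _ _ _ (by fun_prop) (by fun_prop) (by fun_prop)
      (h1 _ hp)).mul (continuousAt_Coef hent.continuous _ _ _ (by fun_prop)
        (by unfold xshift; fun_prop) (by unfold yshift; fun_prop) (h3 _ hp _ hq))
  · refine tendsto_finsetSum _ fun P hP => ?_
    obtain ⟨hp, hq⟩ := mem_product.1 (mem_filter.1 hP).1
    exact (continuousAt_Coef hent.continuous _ _ _ (by fun_prop) (by fun_prop) (by fun_prop)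
      (h2 _ hq)).mul (continuousAt_Coef hent.continuous _ _ _ (by fun_prop)
        (by unfold xshift; fun_prop) (by unfold yshift; fun_prop) (h4 _ hq _ hp))

lemma xshift_xshift_neg (P : ((Fin m → ℕ) × Finset (Fin r)) × ((Fin m → ℕ) × Finset (Fin r)))
    (x : Fin m → ℂ) :
    xshift (-δ) P.2.1 (xshift δ P.1.1 x) = fun i => x i + δ * netShift P (.inl i) := by
  funext i
  simp [xshift, netShift, expVec]
  ring

lemma yshift_yshift_neg (P : ((Fin m → ℕ) × Finset (Fin r)) × ((Fin m → ℕ) × Finset (Fin r)))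
    (y : Fin r → ℂ) :
    yshift (-κ) P.2.2 (yshift κ P.1.2 y) = fun j => y j - κ * netShift P (.inr j) := by
  funext j
  simp only [yshift, netShift, expVec, Sum.elim_inr]
  push_cast
  ring

lemma xshift_comm (a b : ℂ) (μ ν : Fin m → ℕ) (x : Fin m → ℂ) :
    xshift a μ (xshift b ν x) = xshift b ν (xshift a μ x) := by
  funext i
  simp only [xshift]
  ring

lemma yshift_comm (a b : ℂ) (I J : Finset (Fin r)) (y : Fin r → ℂ) :
    yshift a I (yshift b J y) = yshift b J (yshift a I y) := by
  funext j
  simp only [yshift]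
  ring

end AdmissiblePoints

/-- The operators `H_{m,r}^{(k)}` and `Ĥ_{m,r}^{(l)}` commute
at every admissible point. -/
theorem Hop_Hhat_commute
    (br : ℂ → ℂ) (hodd : ∀ z : ℂ, br (-z) = -br z)
    (hent : Differentiable ℂ br) (hnz : br ≠ 0)
    (hW : ∀ a b c d : ℂ,
      br (a + b) * br (a - b) * br (c + d) * br (c - d)
        + br (a + d) * br (a - d) * br (b + c) * br (b - c)
        = br (a + c) * br (a - c) * br (b + d) * br (b - d))
    (δ κ : ℂ)
    (hδ : ∀ n : ℕ, 1 ≤ n → br ((n : ℂ) * δ) ≠ 0)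
    (hκ : ∀ n : ℕ, 1 ≤ n → br ((n : ℂ) * κ) ≠ 0)
    (m r k l : ℕ) (F : (Fin m → ℂ) → (Fin r → ℂ) → ℂ)
    (x : Fin m → ℂ) (y : Fin r → ℂ)
    (h1 : ∀ p ∈ idxSet m r k, CDenomNZ br δ p.1 p.2 x y)
    (h2 : ∀ p ∈ idxSet m r l,
      CDenomNZ br (-δ) p.1 p.2 (fun i => x i - δ) (fun j => y j + κ))
    (h3 : ∀ p ∈ idxSet m r k, ∀ q ∈ idxSet m r l,
      CDenomNZ br (-δ) q.1 q.2 (fun i => xshift δ p.1 x i - δ)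
        (fun j => yshift κ p.2 y j + κ))
    (h4 : ∀ p ∈ idxSet m r l, ∀ q ∈ idxSet m r k,
      CDenomNZ br δ q.1 q.2 (xshift (-δ) p.1 x) (yshift (-κ) p.2 y)) :
    Hop br δ κ m r k (fun x' y' => Hhat br δ κ m r l F x' y') x y
      = Hhat br δ κ m r l (fun x' y' => Hop br δ κ m r k F x' y') x y := by
  have hL : ∀ P ∈ idxSet m r k ×ˢ idxSet m r l,
      Coef br δ κ P.1.1 P.1.2 x y * (Coef br (-δ) (-κ) P.2.1 P.2.2
        (fun i => xshift δ P.1.1 x i - δ) (fun j => yshift κ P.1.2 y j + κ)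
        * F (xshift (-δ) P.2.1 (xshift δ P.1.1 x)) (yshift (-κ) P.2.2 (yshift κ P.1.2 y)))
      = coefHHhat br δ κ P.1 P.2 x y *
        F (fun i => x i + δ * netShift P (.inl i)) (fun j => y j - κ * netShift P (.inr j)) := by
    intro P _
    rw [xshift_xshift_neg, yshift_yshift_neg, coefHHhat, mul_assoc]
  have hR : ∀ P ∈ idxSet m r k ×ˢ idxSet m r l,
      Coef br (-δ) (-κ) P.2.1 P.2.2 (fun i => x i - δ) (fun j => y j + κ) *
        (Coef br δ κ P.1.1 P.1.2 (xshift (-δ) P.2.1 x) (yshift (-κ) P.2.2 y)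
        * F (xshift δ P.1.1 (xshift (-δ) P.2.1 x)) (yshift κ P.1.2 (yshift (-κ) P.2.2 y)))
      = coefHhatH br δ κ P.1 P.2 x y *
        F (fun i => x i + δ * netShift P (.inl i)) (fun j => y j - κ * netShift P (.inr j)) := by
    intro P _
    rw [xshift_comm, yshift_comm, xshift_xshift_neg, yshift_yshift_neg, coefHhatH, mul_assoc]
  simp only [Hop, Hhat, mul_sum]
  rw [sum_comm (s := idxSet m r l), ← sum_product', ← sum_product', sum_congr rfl hL,
    sum_congr rfl hR]
  have hmaps : ∀ P ∈ idxSet m r k ×ˢ idxSet m r l,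
      netShift P ∈ (idxSet m r k ×ˢ idxSet m r l).image netShift :=
    fun P hP => mem_image_of_mem _ hP
  rw [← sum_fiberwise_of_maps_to hmaps, ← sum_fiberwise_of_maps_to hmaps]
  refine sum_congr rfl fun c _ => ?_
  have hconst : ∀ G : ((Fin m → ℕ) × Finset (Fin r)) × ((Fin m → ℕ) × Finset (Fin r)) → ℂ,
      ∑ P ∈ (idxSet m r k ×ˢ idxSet m r l).filter (fun P => netShift P = c), G P *
        F (fun i => x i + δ * netShift P (.inl i)) (fun j => y j - κ * netShift P (.inr j))
      = (∑ P ∈ (idxSet m r k ×ˢ idxSet m r l).filter (fun P => netShift P = c), G P) *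
        F (fun i => x i + δ * c (.inl i)) (fun j => y j - κ * c (.inr j)) := by
    intro G
    rw [sum_mul]
    refine sum_congr rfl fun P hP => ?_
    rw [(mem_filter.1 hP).2]
  rw [hconst fun P => coefHHhat br δ κ P.1 P.2 x y, hconst fun P => coefHhatH br δ κ P.1 P.2 x y,
    sum_coef_comm_of_admissible hodd hent hnz hW hδ h1 h2 h3 h4 c]
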